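/- For every natural number n > 0, a cardinal κ is weakly Π¹ₙ-indescribable if and only if it is weakly (Σₙ₊₁,∅,κ⁺)-shrewd. -/

import Mathlib

universe u

open Cardinal

/-- Formulas of the language of set theory with an additional unary predicate
symbol `pred`; variables are indexed by natural numbers. -/
inductive SF : Type
  | mem : ℕ → ℕ → SF
  | eq : ℕ → ℕ → SF
  | pred : ℕ → SF
  | not : SF → SF
  | and : SF → SF → SF
  | ex : ℕ → SF → SF

/-- The free variables of a formula. -/
def SF.fv : SF → Set ℕ
  | .mem i j => {i, j}
  | .eq i j => {i, j}
  | .pred i => {i}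
  | .not φ => φ.fv
  | .and φ ψ => φ.fv ∪ ψ.fv
  | .ex k φ => φ.fv \ {k}

/-- Tarskian satisfaction of a formula in the structure whose carrier is the
class `S`, where the membership symbol is interpreted by the binary relation `E`
and the extra unary predicate symbol by the class `P`, under the valuation `v`. -/
def Sat (P : Set ZFSet.{u}) (E : ZFSet.{u} → ZFSet.{u} → Prop) (S : Set ZFSet.{u}) :
    SF → (ℕ → ZFSet.{u}) → Prop
  | .mem i j, v => E (v i) (v j)
  | .eq i j, v => v i = v j
  | .pred i, v => v i ∈ P
  | .not φ, v => ¬ Sat P E S φ v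
  | .and φ ψ, v => Sat P E S φ v ∧ Sat P E S ψ v
  | .ex k φ, v => ∃ x, x ∈ S ∧ Sat P E S φ (Function.update v k x)

/-- Satisfaction in the `∈`-structure with carrier `S`, the predicate symbol
being interpreted by the class `R`. -/
def SatIn (R : Set ZFSet.{u}) (S : Set ZFSet.{u}) (φ : SF) (v : ℕ → ZFSet.{u}) : Prop :=
  Sat R (· ∈ ·) S φ v

/-- Δ₀-formulas: built from atomic formulas by propositional connectives and
bounded existential quantification. -/
inductive IsDeltaZero : SF → Prop
  | mem (i j) : IsDeltaZero (.mem i j)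
  | eq (i j) : IsDeltaZero (.eq i j)
  | pred (i) : IsDeltaZero (.pred i)
  | not {φ} : IsDeltaZero φ → IsDeltaZero (.not φ)
  | and {φ ψ} : IsDeltaZero φ → IsDeltaZero ψ → IsDeltaZero (.and φ ψ)
  | bex {φ} (k j) : IsDeltaZero φ → IsDeltaZero (.ex k (.and (.mem k j) φ))

mutual
  /-- Σₙ-formulas of the Lévy hierarchy. -/
  inductive IsSigma : ℕ → SF → Prop
    | of_zero {φ} : IsDeltaZero φ → IsSigma 0 φ
    | of_pi {n φ} : IsPi n φ → IsSigma (n + 1) φ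
    | ex {n φ} (k) : IsSigma (n + 1) φ → IsSigma (n + 1) (.ex k φ)
  /-- Πₙ-formulas of the Lévy hierarchy. -/
  inductive IsPi : ℕ → SF → Prop
    | of_zero {φ} : IsDeltaZero φ → IsPi 0 φ
    | not {n φ} : IsSigma (n + 1) φ → IsPi (n + 1) (.not φ)
end

/-- The valuation sending `v₀` to `a`, `v₁` to `b` and all other variables to `∅`. -/
def val2 (a b : ZFSet.{u}) : ℕ → ZFSet.{u} := fun i => if i = 0 then a else if i = 1 then b else ∅

/-- `x` is a (von Neumann) ordinal. -/
def ZOrd (x : ZFSet.{u}) : Prop := x.IsTransitive ∧ ∀ y ∈ x, ZFSet.IsTransitive y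

/-- `κ` is a (von Neumann) cardinal. -/
def ZCard (κ : ZFSet.{u}) : Prop := ZOrd κ ∧ ∀ β ∈ κ, #β.toSet < #κ.toSet

/-- `κ` is an infinite cardinal. -/
def InfCard (κ : ZFSet.{u}) : Prop := ZCard κ ∧ ZFSet.omega ⊆ κ

/-- `κ` is an infinite regular cardinal: every cofinal subset of `κ` has
cardinality `κ`. -/
def ZRegular (κ : ZFSet.{u}) : Prop :=
  InfCard κ ∧ ∀ x : ZFSet.{u}, x ⊆ κ →
    (∀ β ∈ κ, ∃ γ ∈ x, β ∈ γ ∨ β = γ) → #x.toSet = #κ.toSet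

/-- `C` is a closed unbounded (class of) subset(s) of the ordinal `κ`. -/
def ZClub (C : Set ZFSet.{u}) (κ : ZFSet.{u}) : Prop :=
  (∀ γ ∈ C, γ ∈ κ) ∧ (∀ β ∈ κ, ∃ γ ∈ C, β ∈ γ) ∧
    (∀ β ∈ κ, (∃ γ, γ ∈ β) → (∀ γ ∈ β, ∃ δ ∈ C, γ ∈ δ ∧ δ ∈ β) → β ∈ C)

/-- `S` is stationary in `κ`: it meets every closed unbounded subset of `κ`. -/
def ZStationary (S : Set ZFSet.{u}) (κ : ZFSet.{u}) : Prop :=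
  ∀ C, ZClub C κ → ∃ γ ∈ C, γ ∈ S

/-- `H(θ)`: the class of all sets hereditarily of cardinality less than `θ`. -/
def HSet (θ : ZFSet.{u}) : Set ZFSet.{u} :=
  {x | ∃ t : ZFSet.{u}, t.IsTransitive ∧ x ⊆ t ∧ #t.toSet < #θ.toSet}

/-- `θ` is the cardinal successor `κ⁺` of `κ`. -/
def SuccCardOf (θ κ : ZFSet.{u}) : Prop :=
  ZCard θ ∧ κ ∈ θ ∧ ∀ μ, ZCard μ → κ ∈ μ → θ ⊆ μ

/-- `κ` is a weakly shrewd cardinal. -/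
def WeaklyShrewd (κ : ZFSet.{u}) : Prop :=
  InfCard κ ∧
    ∀ (φ : SF) (θ A : ZFSet.{u}), φ.fv ⊆ {0, 1} → ZCard θ → κ ∈ θ → A ⊆ κ →
      SatIn ∅ (HSet θ) φ (val2 A κ) →
      ∃ κ' θ' : ZFSet.{u}, ZCard κ' ∧ ZCard θ' ∧ κ' ∈ θ' ∧ κ' ∈ κ ∧
        SatIn ∅ (HSet θ') φ (val2 (A ∩ κ') κ')

/-- `j` is an elementary embedding of the `∈`-structure (with predicate `R`)
with carrier `X` into the one with carrier `Y`. -/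
def ElemEmbOn (R : Set ZFSet.{u}) (X Y : Set ZFSet.{u}) (j : ZFSet.{u} → ZFSet.{u}) : Prop :=
  (∀ x ∈ X, j x ∈ Y) ∧
    ∀ (φ : SF) (v : ℕ → ZFSet.{u}), (∀ i, v i ∈ X) →
      (SatIn R X φ v ↔ SatIn R Y φ (fun i => j (v i)))

/-- `X` is an elementary submodel of `Y` (as `∈`-structures with predicate `R`). -/
def ElemSub (R : Set ZFSet.{u}) (X Y : Set ZFSet.{u}) : Prop :=
  X ⊆ Y ∧ ∀ (φ : SF) (v : ℕ → ZFSet.{u}), (∀ i, v i ∈ X) → (SatIn R X φ v ↔ SatIn R Y φ v)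

/-- `X` is a Σₙ-elementary submodel of `Y`. -/
def SigmaElemSub (R : Set ZFSet.{u}) (n : ℕ) (X Y : Set ZFSet.{u}) : Prop :=
  X ⊆ Y ∧ ∀ (φ : SF), IsSigma n φ → ∀ (v : ℕ → ZFSet.{u}), (∀ i, v i ∈ X) →
    (SatIn R X φ v ↔ SatIn R Y φ v)

/-- Second-order formulas over structures `⟨κ, ∈, A₀, A₁, …⟩`, with first-order
variables, second-order (relation) variables `svar`, and relation symbols `rel`
(each applied to a list of first-order variables). -/
inductive SO : Type
  | mem : ℕ → ℕ → SO
  | eq : ℕ → ℕ → SO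
  | rel : ℕ → List ℕ → SO
  | svar : ℕ → List ℕ → SO
  | not : SO → SO
  | and : SO → SO → SO
  | fex : ℕ → SO → SO
  | sall : ℕ → SO → SO

/-- The free first-order variables of a second-order formula. -/
def SO.fvF : SO → Set ℕ
  | .mem i j => {i, j}
  | .eq i j => {i, j}
  | .rel _ l => {i | i ∈ l}
  | .svar _ l => {i | i ∈ l}
  | .not φ => φ.fvF
  | .and φ ψ => φ.fvF ∪ ψ.fvF
  | .fex k φ => φ.fvF \ {k}
  | .sall _ φ => φ.fvF

/-- The free second-order variables of a second-order formula. -/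
def SO.fvS : SO → Set ℕ
  | .mem _ _ => ∅
  | .eq _ _ => ∅
  | .rel _ _ => ∅
  | .svar k _ => {k}
  | .not φ => φ.fvS
  | .and φ ψ => φ.fvS ∪ ψ.fvS
  | .fex _ φ => φ.fvS
  | .sall k φ => φ.fvS \ {k}

/-- A second-order sentence: no free variables of either kind. -/
def SO.Sentence (φ : SO) : Prop := φ.fvF = ∅ ∧ φ.fvS = ∅

/-- Satisfaction of a second-order formula in the structure with first-order
domain `D`, relation symbols interpreted by `I`, under the first-order
valuation `v` and second-order valuation `w`; second-order quantifiers range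
over all finitary relations on `D`. -/
def SatSO (D : Set ZFSet.{u}) (I : ℕ → Set (List ZFSet.{u})) :
    SO → (ℕ → ZFSet.{u}) → (ℕ → Set (List ZFSet.{u})) → Prop
  | .mem i j, v, _ => v i ∈ v j
  | .eq i j, v, _ => v i = v j
  | .rel k l, v, _ => l.map v ∈ I k
  | .svar k l, v, w => l.map v ∈ w k
  | .not φ, v, w => ¬ SatSO D I φ v w
  | .and φ ψ, v, w => SatSO D I φ v w ∧ SatSO D I ψ v w
  | .fex k φ, v, w => ∃ x, x ∈ D ∧ SatSO D I φ (Function.update v k x) w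
  | .sall k φ, v, w =>
      ∀ X : Set (List ZFSet.{u}), (∀ l ∈ X, ∀ x ∈ l, x ∈ D) →
        SatSO D I φ v (Function.update w k X)

/-- First-order formulas: no second-order quantifier. -/
inductive SO.FO : SO → Prop
  | mem (i j) : SO.FO (.mem i j)
  | eq (i j) : SO.FO (.eq i j)
  | rel (k l) : SO.FO (.rel k l)
  | svar (k l) : SO.FO (.svar k l)
  | not {φ} : SO.FO φ → SO.FO (.not φ)
  | and {φ ψ} : SO.FO φ → SO.FO ψ → SO.FO (.and φ ψ)
  | fex {φ} (k) : SO.FO φ → SO.FO (.fex k φ)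

mutual
  /-- `Π¹ₙ`-formulas. -/
  inductive IsPiOne : ℕ → SO → Prop
    | of_fo {φ} : SO.FO φ → IsPiOne 0 φ
    | of_sigma {n φ} : IsSigmaOne n φ → IsPiOne (n + 1) φ
    | sall {n φ} (k) : IsPiOne (n + 1) φ → IsPiOne (n + 1) (.sall k φ)
  /-- `Σ¹ₙ`-formulas. -/
  inductive IsSigmaOne : ℕ → SO → Prop
    | of_fo {φ} : SO.FO φ → IsSigmaOne 0 φ
    | of_pi {n φ} : IsPiOne n φ → IsSigmaOne (n + 1) φ
    | sex {n φ} (k) : IsSigmaOne (n + 1) φ → IsSigmaOne (n + 1) (.not (.sall k (.not φ)))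
end

/-- The restriction of the relations `I` to the domain `lam`. -/
def restrictRel (I : ℕ → Set (List ZFSet.{u})) (lam : ZFSet.{u}) :
    ℕ → Set (List ZFSet.{u}) :=
  fun k => {l ∈ I k | ∀ x ∈ l, x ∈ lam}

/-- `κ` is weakly `Π¹ₙ`-indescribable: every `Π¹ₙ`-sentence over
`⟨κ, ∈, A₀, A₁, …⟩` (with finitary relations `Aᵢ` on `κ`) reflects to
`⟨λ, ∈, A₀ ∩ λ, A₁ ∩ λ, …⟩` for some ordinal `λ < κ`. -/
def WeaklyPiOneIndescribable (n : ℕ) (κ : ZFSet.{u}) : Prop :=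
  InfCard κ ∧
    ∀ (Φ : SO) (I : ℕ → Set (List ZFSet.{u})), IsPiOne n Φ → Φ.Sentence →
      (∀ k, ∀ l ∈ I k, ∀ x ∈ l, x ∈ κ) →
      SatSO κ.toSet I Φ (fun _ => ∅) (fun _ => ∅) →
      ∃ lam : ZFSet.{u}, lam ∈ κ ∧
        SatSO lam.toSet (restrictRel I lam) Φ (fun _ => ∅) (fun _ => ∅)

/-- `κ` is weakly `(Σₙ, R, θ)`-shrewd. -/
def WeaklyShrewdAt (R : Set ZFSet.{u}) (n : ℕ) (θ κ : ZFSet.{u}) : Prop :=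
  InfCard κ ∧ κ ∈ θ ∧
    ∀ (φ : SF) (A : ZFSet.{u}), φ.fv ⊆ {0, 1} → IsSigma n φ → A ⊆ κ →
      SatIn R (HSet θ) φ (val2 A κ) →
      ∃ κ' θ' : ZFSet.{u}, ZCard κ' ∧ ZCard θ' ∧ κ' ∈ θ' ∧ κ' ∈ κ ∧
        SatIn R (HSet θ') φ (val2 (A ∩ κ') κ')


/-! ### Basic facts on ordinals, cardinals and `H(θ)` -/

theorem zord_iff {x : ZFSet.{u}} : ZOrd x ↔ x.IsOrdinal :=
  ZFSet.isOrdinal_iff_forall_mem_isTransitive.symm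

theorem mk_toSet_eq (x : ZFSet.{u}) : #x.toSet = Cardinal.lift.{u + 1, u} x.card :=
  ZFSet.cardinalMk_coe_sort

theorem mk_toSet_lt {x y : ZFSet.{u}} : #x.toSet < #y.toSet ↔ x.card < y.card := by
  rw [mk_toSet_eq, mk_toSet_eq, Cardinal.lift_lt]

theorem zcard_iff {κ : ZFSet.{u}} : ZCard κ ↔ κ.IsOrdinal ∧ ∀ β ∈ κ, β.card < κ.card := by
  unfold ZCard
  simp only [zord_iff, mk_toSet_lt]

theorem mem_toSet_iff {x y : ZFSet.{u}} : x ∈ y.toSet ↔ x ∈ y := Iff.rfl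

/-- the canonical successor cardinal -/
noncomputable def scard (κ : ZFSet.{u}) : ZFSet.{u} := (Order.succ κ.card).ord.toZFSet

theorem card_scard (κ : ZFSet.{u}) : (scard κ).card = Order.succ κ.card := by
  unfold scard
  rw [Ordinal.card_toZFSet, Cardinal.card_ord]

theorem zcard_scard (κ : ZFSet.{u}) : ZCard (scard κ) := by
  rw [zcard_iff]
  refine ⟨ZFSet.isOrdinal_toZFSet _, fun β hβ => ?_⟩
  rw [card_scard]
  unfold scard at hβ
  rw [Ordinal.mem_toZFSet_iff] at hβ
  obtain ⟨a, ha, rfl⟩ := hβ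
  rw [Ordinal.card_toZFSet]
  exact Cardinal.lt_ord.1 ha

theorem mem_of_card_lt {x y : ZFSet.{u}} (hx : x.IsOrdinal) (hy : y.IsOrdinal)
    (h : x.card < y.card) : x ∈ y := by
  rcases ZFSet.IsOrdinal.mem_or_subset hx hy with h' | h'
  · exact h'
  · exact absurd (ZFSet.card_mono h') (not_le.2 h)

theorem mem_scard {κ : ZFSet.{u}} (h : κ.IsOrdinal) : κ ∈ scard κ := by
  refine mem_of_card_lt h (ZFSet.isOrdinal_toZFSet _) ?_
  have := card_scard κ
  unfold scard at this
  rw [scard, this]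
  exact Order.lt_succ _

/-- sets of hereditary cardinality at most that of `K` -/
def HS (K : ZFSet.{u}) : Set ZFSet.{u} :=
  {x | ∃ t : ZFSet.{u}, t.IsTransitive ∧ x ⊆ t ∧ t.card ≤ K.card}

theorem HSet_eq_HS {θ κ : ZFSet.{u}} (h : θ.card = Order.succ κ.card) : HSet θ = HS κ := by
  ext x
  unfold HSet HS
  simp only [Set.mem_ofPred_eq, mk_toSet_lt, h, Order.lt_succ_iff]

theorem succCardOf_card {θ κ : ZFSet.{u}} (h : SuccCardOf θ κ) : θ.card = Order.succ κ.card := by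
  obtain ⟨h1, h2, h3⟩ := h
  rw [zcard_iff] at h1
  apply le_antisymm
  · rw [← card_scard]
    exact ZFSet.card_mono (h3 _ (zcard_scard κ) (mem_scard (h1.1.mem h2)))
  · exact Order.succ_le_of_lt (h1.2 _ h2)

theorem HSet_trans {θ : ZFSet.{u}} : ∀ x ∈ HSet θ, ∀ y ∈ x, y ∈ HSet θ := by
  rintro x ⟨t, ht, hxt, hc⟩ y hy
  exact ⟨t, ht, ht y (hxt hy), hc⟩

theorem HS_trans {θ : ZFSet.{u}} : ∀ x ∈ HS θ, ∀ y ∈ x, y ∈ HS θ := by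
  rintro x ⟨t, ht, hxt, hc⟩ y hy
  exact ⟨t, ht, ht y (hxt hy), hc⟩

/-- Mostowski style recursion. -/
theorem exists_coll {α : Type*} (R : α → α → Prop) (wf : WellFounded R)
    (hs : ∀ a, Small.{u} {b // R b a}) (c : ZFSet.{u}) :
    ∃ f : α → ZFSet.{u}, ∀ a z, z ∈ f a ↔ z ∈ c ∨ ∃ b, R b a ∧ f b = z := by
  classical
  refine ⟨wf.fix (fun a ih => c ∪ ZFSet.range (fun b : {b // R b a} => ih b.1 b.2)), ?_⟩
  intro a z
  rw [wf.fix_eq]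
  simp

theorem card_le_of_surj {x y : ZFSet.{u}} (f : ZFSet.{u} → ZFSet.{u})
    (h : ∀ z ∈ y, ∃ a ∈ x, f a = z) : y.card ≤ x.card := by
  rw [← Cardinal.lift_le.{u+1}, ← ZFSet.cardinalMk_coe_sort, ← ZFSet.cardinalMk_coe_sort]
  choose! g hg hfg using h
  refine Cardinal.mk_le_of_injective (f := fun z : y => (⟨g z.1, hg _ z.2⟩ : x)) ?_
  intro a b hab
  have : g a.1 = g b.1 := congrArg Subtype.val hab
  exact Subtype.ext (by rw [← hfg _ a.2, ← hfg _ b.2, this])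

theorem exists_surj {x y : ZFSet.{u}} (h : y.card ≤ x.card) (hne : ∃ z, z ∈ y) :
    ∃ f : ZFSet.{u} → ZFSet.{u}, (∀ a ∈ x, f a ∈ y) ∧ ∀ z ∈ y, ∃ a ∈ x, f a = z := by
  classical
  rw [← Cardinal.lift_le.{u+1}, ← ZFSet.cardinalMk_coe_sort, ← ZFSet.cardinalMk_coe_sort] at h
  obtain ⟨⟨g, hg⟩⟩ := h
  obtain ⟨z0, hz0⟩ := hne
  refine ⟨fun a => if h : ∃ z : y, (g z).1 = a then h.choose.1 else z0, ?_, ?_⟩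
  · intro a _
    dsimp only
    split_ifs with h
    · exact h.choose.2
    · exact hz0
  · intro z hz
    refine ⟨(g ⟨z, hz⟩).1, (g ⟨z, hz⟩).2, ?_⟩
    have h : ∃ z' : y, (g z').1 = (g ⟨z, hz⟩).1 := ⟨_, rfl⟩
    dsimp only
    rw [dif_pos h]
    have := hg (Subtype.ext h.choose_spec)
    rw [this]

theorem exists_inj {x y : ZFSet.{u}} (h : x.card ≤ y.card) :
    ∃ f : ZFSet.{u} → ZFSet.{u}, (∀ a ∈ x, f a ∈ y) ∧ ∀ a ∈ x, ∀ b ∈ x, f a = f b → a = b := by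
  classical
  rw [← Cardinal.lift_le.{u+1}, ← ZFSet.cardinalMk_coe_sort, ← ZFSet.cardinalMk_coe_sort] at h
  obtain ⟨⟨g, hg⟩⟩ := h
  refine ⟨fun a => if h : a ∈ x then (g ⟨a, h⟩).1 else ∅, ?_, ?_⟩
  · intro a ha
    simp only [dif_pos ha]
    exact (g ⟨a, ha⟩).2
  · intro a ha b hb hab
    simp only [dif_pos ha, dif_pos hb] at hab
    exact congrArg Subtype.val (hg (Subtype.ext hab))

/-! ### First-order definability over `⟨K, ∈⟩` with second-order parameters -/

abbrev Rels := Set (List ZFSet.{u})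

/-- definability by a first-order formula, relative to a side condition `H` -/
def FD (H : ZFSet.{u} → (ℕ → Rels.{u}) → Prop)
    (P : ZFSet.{u} → (ℕ → ZFSet.{u}) → (ℕ → Rels.{u}) → Prop) : Prop :=
  ∃ ψ : SO, ψ.FO ∧ ∀ (K : ZFSet.{u}) (I : ℕ → Rels.{u}) (v : ℕ → ZFSet.{u}) (w : ℕ → Rels.{u}),
    H K w → (∀ i, v i ∈ K) → (SatSO K.toSet I ψ v w ↔ P K v w)

theorem upd_mem {K : ZFSet.{u}} {v : ℕ → ZFSet.{u}} (hv : ∀ i, v i ∈ K) {x : ZFSet.{u}}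
    (hx : x ∈ K) (k : ℕ) : ∀ i, Function.update v k x i ∈ K := by
  intro i
  by_cases h : i = k
  · subst h; simpa using hx
  · simpa [h] using hv i

namespace FD

variable {H : ZFSet.{u} → (ℕ → Rels.{u}) → Prop}
  {P P' : ZFSet.{u} → (ℕ → ZFSet.{u}) → (ℕ → Rels.{u}) → Prop}

theorem congr (h : FD H P)
    (e : ∀ K v w, H K w → (∀ i, v i ∈ K) → (P K v w ↔ P' K v w)) : FD H P' := by
  obtain ⟨ψ, h1, h2⟩ := h
  exact ⟨ψ, h1, fun K I v w hH hv => (h2 K I v w hH hv).trans (e K v w hH hv)⟩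

theorem mem (i j : ℕ) : FD H (fun _ v _ => v i ∈ v j) :=
  ⟨.mem i j, .mem i j, fun _ _ _ _ _ _ => Iff.rfl⟩

theorem eq (i j : ℕ) : FD H (fun _ v _ => v i = v j) :=
  ⟨.eq i j, .eq i j, fun _ _ _ _ _ _ => Iff.rfl⟩

theorem svar (k : ℕ) (l : List ℕ) : FD H (fun _ v w => l.map v ∈ w k) :=
  ⟨.svar k l, .svar k l, fun _ _ _ _ _ _ => Iff.rfl⟩

theorem not (h : FD H P) : FD H (fun K v w => ¬ P K v w) := by
  obtain ⟨ψ, h1, h2⟩ := h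
  exact ⟨.not ψ, .not h1, fun K I v w hH hv => not_congr (h2 K I v w hH hv)⟩

theorem and (h : FD H P) (h' : FD H P') : FD H (fun K v w => P K v w ∧ P' K v w) := by
  obtain ⟨ψ, h1, h2⟩ := h
  obtain ⟨ψ', h1', h2'⟩ := h'
  exact ⟨.and ψ ψ', .and h1 h1',
    fun K I v w hH hv => and_congr (h2 K I v w hH hv) (h2' K I v w hH hv)⟩

theorem ex (k : ℕ) (h : FD H P) :
    FD H (fun K v w => ∃ x ∈ K, P K (Function.update v k x) w) := by
  obtain ⟨ψ, h1, h2⟩ := h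
  refine ⟨.fex k ψ, .fex k h1, fun K I v w hH hv => ?_⟩
  simp only [SatSO]
  refine exists_congr fun x => and_congr_right fun hx => ?_
  exact h2 K I _ w hH (upd_mem hv hx k)

theorem imp (h : FD H P) (h' : FD H P') : FD H (fun K v w => P K v w → P' K v w) :=
  (h.and h'.not).not.congr (fun _ _ _ _ _ => by tauto)

theorem iff (h : FD H P) (h' : FD H P') : FD H (fun K v w => P K v w ↔ P' K v w) :=
  ((h.imp h').and (h'.imp h)).congr (fun _ _ _ _ _ => by tauto)

theorem all (k : ℕ) (h : FD H P) :
    FD H (fun K v w => ∀ x ∈ K, P K (Function.update v k x) w) :=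
  (h.not.ex k).not.congr (fun _ _ _ _ _ => by push Not; rfl)

theorem false : FD H (fun _ _ _ => False) :=
  (FD.eq 0 0).not.congr (fun _ _ _ _ _ => by simp)

theorem true : FD H (fun _ _ _ => True) :=
  (FD.eq 0 0).congr (fun _ _ _ _ _ => by simp)

theorem forall_lt (N : ℕ)
    {P : ℕ → ZFSet.{u} → (ℕ → ZFSet.{u}) → (ℕ → Rels.{u}) → Prop} (h : ∀ n, FD H (P n)) :
    FD H (fun K v w => ∀ n < N, P n K v w) := by
  induction N with
  | zero => exact FD.true.congr (fun _ _ _ _ _ => by simp)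
  | succ N ih =>
    exact (ih.and (h N)).congr (fun _ _ _ _ _ => by
      constructor
      · rintro ⟨h1, h2⟩ n hn
        rcases Nat.lt_succ_iff_lt_or_eq.1 hn with h | h
        · exact h1 n h
        · subst h; exact h2
      · intro h
        exact ⟨fun n hn => h n (by omega), h N (by omega)⟩)

end FD

/-! ### Codes -/

/-- triples of `C` witness the well-foundedness of all bounded parts of the
binary part of `C` -/
def GoodC (K : ZFSet.{u}) (C : Rels.{u}) : Prop :=
  (∀ a ∈ K, ∀ b ∈ K, b ∈ a → ∃ c ∈ K, [a, b, c] ∈ C) ∧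
  (∀ a ∈ K, ∀ b ∈ K, ∀ b' ∈ K, ∀ c ∈ K, ∀ c' ∈ K, b ∈ a → b' ∈ a → [b, b'] ∈ C →
    [a, b, c] ∈ C → [a, b', c'] ∈ C → c ∈ c')

theorem FD.goodC {H : ZFSet.{u} → (ℕ → Rels.{u}) → Prop} (l : ℕ) :
    FD H (fun K _ w => GoodC K (w l)) := by
  have h1 := ((FD.mem (H := H) 1 0).imp ((FD.svar l [0, 1, 2]).ex 2)).all 1 |>.all 0
  have h2 := ((FD.mem (H := H) 1 0).imp ((FD.mem 2 0).imp ((FD.svar l [1, 2]).imp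
    ((FD.svar l [0, 1, 3]).imp ((FD.svar l [0, 2, 4]).imp
      (FD.mem 3 4)))))).all 4 |>.all 3 |>.all 2 |>.all 1 |>.all 0
  exact (h1.and h2).congr (fun K v w _ _ => by simp [GoodC])

/-- the first-order part of the statement that `K` is suitable -/
def Gam (K : ZFSet.{u}) (Z : Rels.{u}) : Prop :=
  (∃ x, x ∈ K) ∧
  (¬ ∃ μ ∈ K, (∀ x ∈ K, ∃ y ∈ K, y ∈ μ ∧ [x, y, x, x] ∈ Z) ∧
    ∀ x ∈ K, ∀ x' ∈ K, ∀ y ∈ K, [x, y, x, x] ∈ Z → [x', y, x', x'] ∈ Z → x = x') ∧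
  (GoodC K Z → (∃ x ∈ K, [x] ∈ Z) → ∃ x ∈ K, [x] ∈ Z ∧ ∀ y ∈ K, [y] ∈ Z → [y, x] ∉ Z)

theorem FD.gam {H : ZFSet.{u} → (ℕ → Rels.{u}) → Prop} (l : ℕ) :
    FD H (fun K _ w => Gam K (w l)) := by
  have h1 := (FD.true (H := H)).ex 0
  have h2 := ((((FD.mem (H := H) 2 0).and (FD.svar l [1, 2, 1, 1])).ex 2 |>.all 1).and
    (((FD.svar l [1, 3, 1, 1]).imp ((FD.svar l [2, 3, 2, 2]).imp (FD.eq 1 2))).all 3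
      |>.all 2 |>.all 1)).ex 0 |>.not
  have h3 := (FD.goodC (H := H) l).imp (((FD.svar l [0]).ex 0).imp
    (((FD.svar l [0]).and (((FD.svar l [1]).imp (FD.svar l [1, 0]).not).all 1)).ex 0))
  exact (h1.and (h2.and h3)).congr (fun K v w _ _ => by simp [Gam])

/-- `K` is suitable -/
def KN (K : ZFSet.{u}) : Prop :=
  K.IsOrdinal ∧ ∀ Z : Rels.{u}, (∀ l ∈ Z, ∀ x ∈ l, x ∈ K) → Gam K Z

theorem KN.zcard {K : ZFSet.{u}} (hK : KN K) : ZCard K := by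
  rw [zcard_iff]
  refine ⟨hK.1, fun β hβ => ?_⟩
  by_contra hc
  push Not at hc
  obtain ⟨f, hf, hinj⟩ := exists_inj hc
  have hb : ∀ x ∈ K, f x ∈ K := fun x hx => hK.1.mem_trans (hf x hx) hβ
  obtain ⟨-, h, -⟩ := hK.2 {l | ∃ x ∈ K, l = [x, f x, x, x]} (by
    rintro l ⟨x, hx, rfl⟩ y hy
    simp only [List.mem_cons, List.not_mem_nil, or_false] at hy
    rcases hy with rfl | rfl | rfl | rfl
    exacts [hx, hb _ hx, hx, hx])
  apply h
  refine ⟨β, hβ, fun x hx => ⟨f x, hb x hx, hf x hx, x, hx, rfl⟩, ?_⟩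
  rintro x hx x' hx' y hy ⟨z, hz, e⟩ ⟨z', hz', e'⟩
  simp only [List.cons.injEq, and_true] at e e'
  obtain ⟨rfl, rfl, -⟩ := e
  obtain ⟨rfl, e2, -⟩ := e'
  exact hinj _ hx _ hx' e2

/-- membership relation given by a code -/
def Em (K : ZFSet.{u}) (C : Rels.{u}) (x y : ZFSet.{u}) : Prop :=
  x ∈ K ∧ y ∈ K ∧ [x, y] ∈ C ∧ GoodC K C

theorem Em_wf {K : ZFSet.{u}} (hK : KN K) (C : Rels.{u}) : WellFounded (Em K C) := by
  by_cases hC : GoodC K C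
  swap
  · exact ⟨fun x => ⟨x, fun y hy => absurd hy.2.2.2 hC⟩⟩
  rw [WellFounded.wellFounded_iff_has_min]
  intro s hs
  by_cases hsK : ∃ x ∈ s, x ∈ K
  swap
  · obtain ⟨x, hx⟩ := hs
    exact ⟨x, hx, fun y _ hy => hsK ⟨x, hx, hy.2.1⟩⟩
  obtain ⟨x0, hx0, hx0K⟩ := hsK
  let Z : Rels.{u} := {l | (∀ x ∈ l, x ∈ K) ∧
    ((∃ x ∈ s, l = [x]) ∨ (l ∈ C ∧ (l.length = 2 ∨ l.length = 3)))}
  obtain ⟨-, -, h⟩ := hK.2 Z (fun l hl => hl.1)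
  have e2 : ∀ x ∈ K, ∀ y ∈ K, [x, y] ∈ Z ↔ [x, y] ∈ C := by
    intro x hx y hy
    simp [Z, hx, hy]
  have e3 : ∀ x ∈ K, ∀ y ∈ K, ∀ z ∈ K, [x, y, z] ∈ Z ↔ [x, y, z] ∈ C := by
    intro x hx y hy z hz
    simp [Z, hx, hy, hz]
  have e1 : ∀ x ∈ K, [x] ∈ Z ↔ x ∈ s := by
    intro x hx
    simp [Z, hx]
  have hg : GoodC K Z := by
    refine ⟨fun a ha b hb hab => ?_, fun a ha b hb b' hb' c hc c' hc' h1 h2 h3 h4 h5 => ?_⟩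
    · obtain ⟨c, hc, h⟩ := hC.1 a ha b hb hab
      exact ⟨c, hc, (e3 a ha b hb c hc).2 h⟩
    · exact hC.2 a ha b hb b' hb' c hc c' hc' h1 h2 ((e2 b hb b' hb').1 h3)
        ((e3 a ha b hb c hc).1 h4) ((e3 a ha b' hb' c' hc').1 h5)
  obtain ⟨x, hx, hxs, hmin⟩ := h hg ⟨x0, hx0K, (e1 _ hx0K).2 hx0⟩
  refine ⟨x, (e1 _ hx).1 hxs, fun y hy hyx => ?_⟩
  exact hmin y hyx.1 ((e1 _ hyx.1).2 hy) ((e2 _ hyx.1 _ hx).2 hyx.2.2.1)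

theorem zsmall_sub (K : ZFSet.{u}) (p : ZFSet.{u} → Prop) (h : ∀ x, p x → x ∈ K) :
    Small.{u} {x // p x} :=
  small_of_injective (β := K) (f := fun x => ⟨x.1, h _ x.2⟩)
    (fun _ _ hab => Subtype.ext (congrArg (fun z : K => z.1) hab))

open Classical in
/-- the Mostowski collapse of a code -/
noncomputable def col (K : ZFSet.{u}) (C : Rels.{u}) : ZFSet.{u} → ZFSet.{u} :=
  if h : WellFounded (Em K C) then
    (exists_coll (Em K C) h (fun _ => zsmall_sub K _ (fun _ hx => hx.1)) ∅).choose
  else fun _ => ∅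

theorem mem_col {K : ZFSet.{u}} (hK : KN K) (C : Rels.{u}) (y z : ZFSet.{u}) :
    z ∈ col K C y ↔ ∃ x, Em K C x y ∧ col K C x = z := by
  unfold col
  rw [dif_pos (Em_wf hK C)]
  have := (exists_coll (Em K C) (Em_wf hK C) (fun _ => zsmall_sub K _ (fun _ hx => hx.1)) ∅).choose_spec y z
  simpa using this

/-- the set coded by `C` -/
noncomputable def top (K : ZFSet.{u}) (C : Rels.{u}) : ZFSet.{u} :=
  haveI : Small.{u} {x // x ∈ K ∧ [x] ∈ C ∧ GoodC K C} := zsmall_sub K _ (fun _ h => h.1)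
  ZFSet.range (fun x : {x // x ∈ K ∧ [x] ∈ C ∧ GoodC K C} => col K C x.1)

theorem mem_top {K : ZFSet.{u}} (C : Rels.{u}) (z : ZFSet.{u}) :
    z ∈ top K C ↔ ∃ x ∈ K, ([x] ∈ C ∧ GoodC K C) ∧ col K C x = z := by
  unfold top
  simp
  constructor
  · rintro ⟨x, ⟨h1, h2, h3⟩, h4⟩
    exact ⟨x, h1, ⟨h2, h3⟩, h4⟩
  · rintro ⟨x, h1, ⟨h2, h3⟩, h4⟩
    exact ⟨x, ⟨h1, h2, h3⟩, h4⟩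

theorem range_col {K : ZFSet.{u}} (hK : KN K) (C : Rels.{u}) :
    ∃ t : ZFSet.{u}, t.IsTransitive ∧ t.card ≤ K.card ∧ ∀ x ∈ K, col K C x ∈ t := by
  refine ⟨ZFSet.range (fun x : K => col K C x.1), ?_, ?_, ?_⟩
  · intro y hy z hz
    rw [ZFSet.mem_range] at hy ⊢
    obtain ⟨x, rfl⟩ := hy
    rw [mem_col hK] at hz
    obtain ⟨x', hx', rfl⟩ := hz
    exact ⟨⟨x', hx'.1⟩, rfl⟩
  · refine card_le_of_surj (col K C) ?_
    intro z hz
    rw [ZFSet.mem_range] at hz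
    obtain ⟨x, rfl⟩ := hz
    exact ⟨x.1, x.2, rfl⟩
  · intro x hx
    rw [ZFSet.mem_range]
    exact ⟨⟨x, hx⟩, rfl⟩

theorem top_mem_HS {K : ZFSet.{u}} (hK : KN K) (C : Rels.{u}) : top K C ∈ HS K := by
  obtain ⟨t, h1, h2, h3⟩ := range_col hK C
  refine ⟨t, h1, fun z hz => ?_, h2⟩
  rw [mem_top] at hz
  obtain ⟨x, hx, -, rfl⟩ := hz
  exact h3 x hx

theorem col_mem_HS {K : ZFSet.{u}} (hK : KN K) (C : Rels.{u}) {x : ZFSet.{u}} (hx : x ∈ K) :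
    col K C x ∈ HS K := by
  obtain ⟨t, h1, h2, h3⟩ := range_col hK C
  exact ⟨t, h1, h1 _ (h3 x hx), h2⟩

/-- bounded rank functions exist inside a cardinal -/
theorem exists_rk {K : ZFSet.{u}} (hK : ZCard K) (f : ZFSet.{u} → ZFSet.{u}) {a : ZFSet.{u}}
    (ha : a ∈ K) : ∃ r : ZFSet.{u} → ZFSet.{u}, (∀ b ∈ a, r b ∈ K) ∧
      ∀ b ∈ a, ∀ b' ∈ a, f b ∈ f b' → r b ∈ r b' := by
  rw [zcard_iff] at hK
  let R : ZFSet.{u} → ZFSet.{u} → Prop := fun x y => x ∈ a ∧ (f x).rank < (f y).rank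
  have wf : WellFounded R :=
    Subrelation.wf (r := InvImage (· < ·) (fun x => (f x).rank)) (fun h => h.2)
      (InvImage.wf _ wellFounded_lt)
  obtain ⟨r, hr⟩ := exists_coll R wf (fun _ => zsmall_sub a _ (fun _ h => h.1)) ∅
  simp only [ZFSet.notMem_empty, false_or] at hr
  have htr : ∀ b, (r b).IsTransitive := by
    intro b y hy z hz
    rw [hr] at hy
    obtain ⟨c, hc, rfl⟩ := hy
    rw [hr] at hz ⊢
    obtain ⟨d, hd, rfl⟩ := hz
    exact ⟨d, ⟨hd.1, hd.2.trans hc.2⟩, rfl⟩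
  refine ⟨r, fun b _ => ?_, fun b hb b' _ h => ?_⟩
  · refine mem_of_card_lt (ZFSet.isOrdinal_iff_forall_mem_isTransitive.2 ⟨htr b, ?_⟩) hK.1
      (lt_of_le_of_lt (card_le_of_surj r ?_) (hK.2 a ha))
    · intro y hy
      rw [hr] at hy
      obtain ⟨c, hc, rfl⟩ := hy
      exact htr c
    · intro z hz
      rw [hr] at hz
      obtain ⟨c, hc, rfl⟩ := hz
      exact ⟨c, hc.1, rfl⟩
  · rw [hr]
    exact ⟨b, ⟨hb, ZFSet.rank_lt_of_mem h⟩, rfl⟩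

/-- if `f` is onto a transitive set, then every subset of that set has a code -/
theorem exists_code {K : ZFSet.{u}} (hK : KN K) {y : ZFSet.{u}} (hy : y ∈ HS K) :
    ∃ C : Rels.{u}, (∀ l ∈ C, ∀ x ∈ l, x ∈ K) ∧ top K C = y := by
  obtain ⟨t, ht, hyt, hc⟩ := hy
  by_cases hne : ∃ z, z ∈ t
  swap
  · refine ⟨∅, by simp, ?_⟩
    ext z
    rw [mem_top]
    constructor
    · rintro ⟨x, -, ⟨h, -⟩, -⟩
      exact h.elim
    · intro hz
      exact (hne ⟨z, hyt hz⟩).elim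
  obtain ⟨f, hf, hsurj⟩ := exists_surj hc hne
  have := fun a (ha : a ∈ K) => exists_rk hK.zcard f ha
  choose! r hr hr' using this
  let C : Rels.{u} := {l | (∃ x ∈ K, l = [x] ∧ f x ∈ y) ∨
    (∃ x ∈ K, ∃ x' ∈ K, l = [x, x'] ∧ f x ∈ f x') ∨
    (∃ a ∈ K, ∃ b ∈ a, l = [a, b, r a b])}
  have e1 : ∀ x ∈ K, [x] ∈ C ↔ f x ∈ y := by
    intro x hx
    simp [C, hx]
  have e2 : ∀ x ∈ K, ∀ x' ∈ K, [x, x'] ∈ C ↔ f x ∈ f x' := by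
    intro x hx x' hx'
    simp only [C, Set.mem_ofPred_eq]
    constructor
    · rintro (⟨a, -, h, -⟩ | ⟨a, -, b, -, h, h'⟩ | ⟨a, -, b, -, h⟩)
      · simp at h
      · simp at h
        obtain ⟨rfl, rfl⟩ := h
        exact h'
      · simp at h
    · intro h
      exact Or.inr (Or.inl ⟨x, hx, x', hx', rfl, h⟩)
  have e3 : ∀ a b c, [a, b, c] ∈ C ↔ a ∈ K ∧ b ∈ a ∧ c = r a b := by
    intro a b c
    simp only [C, Set.mem_ofPred_eq]
    constructor
    · rintro (⟨x, -, h, -⟩ | ⟨x, -, y, -, h, h'⟩ | ⟨x, hx, y, hy, h⟩)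
      · simp at h
      · simp at h
      · simp at h
        obtain ⟨rfl, rfl, rfl⟩ := h
        exact ⟨hx, hy, rfl⟩
    · rintro ⟨h1, h2, rfl⟩
      exact Or.inr (Or.inr ⟨a, h1, b, h2, rfl⟩)
  have hg : GoodC K C := by
    refine ⟨fun a ha b hb hab => ⟨r a b, hr a ha b hab, (e3 _ _ _).2 ⟨ha, hab, rfl⟩⟩, ?_⟩
    intro a ha b hb b' hb' c hc c' hc' h1 h2 h3 h4 h5
    rw [e3] at h4 h5
    rw [h4.2.2, h5.2.2]
    exact hr' a ha b h1 b' h2 ((e2 b hb b' hb').1 h3)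
  have hcol : ∀ x, x ∈ K → col K C x = f x := by
    intro x
    induction x using (Em_wf hK C).induction with
    | _ x ih =>
      intro hx
      ext z
      rw [mem_col hK]
      constructor
      · rintro ⟨x', hx', rfl⟩
        rw [ih x' hx' hx'.1]
        exact (e2 x' hx'.1 x hx).1 hx'.2.2.1
      · intro hz
        obtain ⟨x', hx', rfl⟩ := hsurj z (ht _ (hf x hx) hz)
        have : Em K C x' x := ⟨hx', hx, (e2 x' hx' x hx).2 hz, hg⟩
        exact ⟨x', this, ih x' this hx'⟩
  refine ⟨C, ?_, ?_⟩
  · rintro l (⟨x, hx, rfl, -⟩ | ⟨x, hx, x', hx', rfl, -⟩ | ⟨a, ha, b, hb, rfl⟩) z hz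
    · simp at hz
      exact hz ▸ hx
    · simp at hz
      rcases hz with rfl | rfl <;> assumption
    · simp at hz
      rcases hz with rfl | rfl | rfl
      · exact ha
      · exact hK.1.mem_trans hb ha
      · exact hr a ha b hb
  · ext z
    rw [mem_top]
    constructor
    · rintro ⟨x, hx, ⟨h, -⟩, rfl⟩
      rw [hcol x hx]
      exact (e1 x hx).1 h
    · intro hz
      obtain ⟨x, hx, rfl⟩ := hsurj z (hyt hz)
      exact ⟨x, hx, ⟨(e1 x hx).2 hz, hg⟩, hcol x hx⟩

/-- the canonical code of a subset `T` of the ordinal `K` -/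
def idcode (K T : ZFSet.{u}) : Rels.{u} :=
  {l | (∃ x ∈ T, l = [x]) ∨ (∃ x ∈ K, ∃ y ∈ K, l = [x, y] ∧ x ∈ y) ∨
    (∃ a ∈ K, ∃ b ∈ K, l = [a, b, b])}

theorem idcode_dom {K T : ZFSet.{u}} (hT : T ⊆ K) : ∀ l ∈ idcode K T, ∀ x ∈ l, x ∈ K := by
  rintro l (⟨x, hx, rfl⟩ | ⟨x, hx, x', hx', rfl, -⟩ | ⟨a, ha, b, hb, rfl⟩) z hz
  · simp at hz
    exact hz ▸ hT hx
  · simp at hz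
    rcases hz with rfl | rfl <;> assumption
  · simp at hz
    rcases hz with rfl | rfl <;> assumption

theorem top_idcode {K T : ZFSet.{u}} (hK : KN K) (hT : T ⊆ K) : top K (idcode K T) = T := by
  have e1 : ∀ x, [x] ∈ idcode K T ↔ x ∈ T := by
    intro x
    simp [idcode]
  have e2 : ∀ x y, [x, y] ∈ idcode K T ↔ x ∈ K ∧ y ∈ K ∧ x ∈ y := by
    intro x y
    simp [idcode]
  have e3 : ∀ a b c, [a, b, c] ∈ idcode K T ↔ a ∈ K ∧ b ∈ K ∧ c = b := by
    intro a b c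
    simp [idcode]
  have hg : GoodC K (idcode K T) := by
    refine ⟨fun a ha b hb hab => ⟨b, hb, (e3 _ _ _).2 ⟨ha, hb, rfl⟩⟩, ?_⟩
    intro a ha b hb b' hb' c hc c' hc' h1 h2 h3 h4 h5
    rw [e3] at h4 h5
    rw [h4.2.2, h5.2.2]
    exact ((e2 _ _).1 h3).2.2
  have hcol : ∀ x, x ∈ K → col K (idcode K T) x = x := by
    intro x
    induction x using ZFSet.inductionOn with
    | _ x ih =>
      intro hx
      ext z
      rw [mem_col hK]
      constructor
      · rintro ⟨x', hx', rfl⟩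
        have := ((e2 _ _).1 hx'.2.2.1).2.2
        rw [ih x' this hx'.1]
        exact this
      · intro hz
        have hzK := hK.1.mem_trans hz hx
        exact ⟨z, ⟨hzK, hx, (e2 _ _).2 ⟨hzK, hx, hz⟩, hg⟩, ih z hz hzK⟩
  ext z
  rw [mem_top]
  constructor
  · rintro ⟨x, hx, ⟨h, -⟩, rfl⟩
    rw [hcol x hx]
    exact (e1 x).1 h
  · intro hz
    exact ⟨z, hT hz, ⟨(e1 z).2 hz, hg⟩, hcol z (hT hz)⟩

/-! ### Comparing codes -/

theorem FD.em {H : ZFSet.{u} → (ℕ → Rels.{u}) → Prop} (l i j : ℕ) :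
    FD H (fun K v w => Em K (w l) (v i) (v j)) :=
  ((FD.svar l [i, j]).and (FD.goodC l)).congr (fun K v w _ hv => by
    simp [Em, hv i, hv j])

/-- the relation coded by the second-order variable `0` -/
def QH (w : ℕ → Rels.{u}) (l m : ℕ) (x y : ZFSet.{u}) : Prop :=
  (x :: y :: List.replicate (Nat.pair l m) x) ∈ w 0

theorem FD.qh {H : ZFSet.{u} → (ℕ → Rels.{u}) → Prop} (l m i j : ℕ) :
    FD H (fun _ v w => QH w l m (v i) (v j)) :=
  (FD.svar 0 (i :: j :: List.replicate (Nat.pair l m) i)).congr (fun K v w _ _ => by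
    simp [QH])

/-- bisimulation clause -/
def QCl (K : ZFSet.{u}) (w : ℕ → Rels.{u}) (l m : ℕ) (x y : ZFSet.{u}) : Prop :=
  (∀ x' ∈ K, Em K (w (l + 2)) x' x → ∃ y' ∈ K, Em K (w (m + 2)) y' y ∧ QH w l m x' y') ∧
  (∀ y' ∈ K, Em K (w (m + 2)) y' y → ∃ x' ∈ K, Em K (w (l + 2)) x' x ∧ QH w l m x' y')

def QRec (N : ℕ) (K : ZFSet.{u}) (w : ℕ → Rels.{u}) : Prop :=
  ∀ l < N, ∀ m < N, ∀ x ∈ K, ∀ y ∈ K, (QH w l m x y ↔ QCl K w l m x y)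

theorem FD.qrec {H : ZFSet.{u} → (ℕ → Rels.{u}) → Prop} (N : ℕ) :
    FD H (fun K _ w => QRec N K w) := by
  have h := FD.forall_lt N (fun l => FD.forall_lt N (fun m =>
    ((FD.qh (H := H) l m 0 1).iff
      ((((FD.em (l + 2) 2 0).imp (((FD.em (m + 2) 3 1).and (FD.qh l m 2 3)).ex 3)).all 2).and
      (((FD.em (m + 2) 3 1).imp (((FD.em (l + 2) 2 0).and (FD.qh l m 2 3)).ex 2)).all 3))).all 1
      |>.all 0))
  exact h.congr (fun K v w _ _ => by simp [QRec, QCl])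

theorem qh_iff {K : ZFSet.{u}} (hK : KN K) {N : ℕ} {w : ℕ → Rels.{u}} (hQ : QRec N K w)
    {l m : ℕ} (hl : l < N) (hm : m < N) : ∀ x ∈ K, ∀ y ∈ K,
    (QH w l m x y ↔ col K (w (l + 2)) x = col K (w (m + 2)) y) := by
  intro x
  induction x using (Em_wf hK (w (l + 2))).induction with
  | _ x ih =>
    intro hx y hy
    rw [hQ l hl m hm x hx y hy]
    constructor
    · rintro ⟨h1, h2⟩
      ext z
      rw [mem_col hK, mem_col hK]
      constructor
      · rintro ⟨x', hx', rfl⟩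
        obtain ⟨y', hy', he, hq⟩ := h1 x' hx'.1 hx'
        exact ⟨y', he, ((ih x' hx' hx'.1 y' hy').1 hq).symm⟩
      · rintro ⟨y', hy', rfl⟩
        obtain ⟨x', hx', he, hq⟩ := h2 y' hy'.1 hy'
        exact ⟨x', he, (ih x' he hx' y' hy'.1).1 hq⟩
    · intro h
      constructor
      · intro x' hx' he
        have : col K (w (l + 2)) x' ∈ col K (w (m + 2)) y := by
          rw [← h, mem_col hK]; exact ⟨x', he, rfl⟩
        rw [mem_col hK] at this
        obtain ⟨y', he', e⟩ := this
        exact ⟨y', he'.1, he', (ih x' he hx' y' he'.1).2 e.symm⟩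
      · intro y' hy' he
        have : col K (w (m + 2)) y' ∈ col K (w (l + 2)) x := by
          rw [h, mem_col hK]; exact ⟨y', he, rfl⟩
        rw [mem_col hK] at this
        obtain ⟨x', he', e⟩ := this
        exact ⟨x', he'.1, he', (ih x' he' he'.1 y' hy').2 e⟩

theorem exists_Q {K : ZFSet.{u}} (hK : KN K) (w : ℕ → Rels.{u}) :
    ∃ Q : Rels.{u}, (∀ L ∈ Q, ∀ x ∈ L, x ∈ K) ∧ ∀ N, QRec N K (Function.update w 0 Q) := by
  let Q : Rels.{u} := {L | ∃ l m : ℕ, ∃ x ∈ K, ∃ y ∈ K,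
    L = x :: y :: List.replicate (Nat.pair l m) x ∧ col K (w (l + 2)) x = col K (w (m + 2)) y}
  have e : ∀ l m, ∀ x ∈ K, ∀ y ∈ K, QH (Function.update w 0 Q) l m x y ↔
      col K (w (l + 2)) x = col K (w (m + 2)) y := by
    intro l m x hx y hy
    simp only [QH, Function.update_self]
    constructor
    · rintro ⟨l', m', x', -, y', -, h, h'⟩
      simp only [List.cons.injEq] at h
      obtain ⟨rfl, rfl, h⟩ := h
      have := congrArg List.length h
      simp only [List.length_replicate] at this
      obtain ⟨rfl, rfl⟩ := Nat.pair_eq_pair.1 this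
      exact h'
    · intro h
      exact ⟨l, m, x, hx, y, hy, rfl, h⟩
  refine ⟨Q, ?_, ?_⟩
  · rintro L ⟨l, m, x, hx, y, hy, rfl, -⟩ z hz
    simp only [List.mem_cons, List.mem_replicate] at hz
    rcases hz with rfl | rfl | ⟨-, rfl⟩ <;> assumption
  · intro N l _ m _ x hx y hy
    rw [e l m x hx y hy]
    have h0 : ∀ k, Function.update w 0 Q (k + 2) = w (k + 2) := fun k => by simp
    unfold QCl
    rw [h0, h0]
    constructor
    · intro h
      constructor
      · intro x' hx' he
        have : col K (w (l + 2)) x' ∈ col K (w (m + 2)) y := by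
          rw [← h, mem_col hK]; exact ⟨x', he, rfl⟩
        rw [mem_col hK] at this
        obtain ⟨y', he', e'⟩ := this
        exact ⟨y', he'.1, he', (e l m x' hx' y' he'.1).2 e'.symm⟩
      · intro y' hy' he
        have : col K (w (m + 2)) y' ∈ col K (w (l + 2)) x := by
          rw [h, mem_col hK]; exact ⟨y', he, rfl⟩
        rw [mem_col hK] at this
        obtain ⟨x', he', e'⟩ := this
        exact ⟨x', he'.1, he', (e l m x' he'.1 y' hy').2 e'⟩
    · rintro ⟨h1, h2⟩
      ext z
      rw [mem_col hK, mem_col hK]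
      constructor
      · rintro ⟨x', hx', rfl⟩
        obtain ⟨y', hy', he, hq⟩ := h1 x' hx'.1 hx'
        exact ⟨y', he, ((e l m x' hx'.1 y' hy').1 hq).symm⟩
      · rintro ⟨y', hy', rfl⟩
        obtain ⟨x', hx', he, hq⟩ := h2 y' hy'.1 hy'
        exact ⟨x', he, (e l m x' hx' y' hy'.1).1 hq⟩

/-- level of a variable -/
def lv (r : Option ℕ) (k : ℕ) : ℕ := r.getD k

/-- value of a variable -/
noncomputable def vl (K : ZFSet.{u}) (w : ℕ → Rels.{u}) :
    Option ℕ → ℕ → ZFSet.{u} → ZFSet.{u}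
  | none, k, _ => top K (w (k + 2))
  | some l, _, a => col K (w (l + 2)) a

/-- coded elements of a variable -/
def mb (K : ZFSet.{u}) (w : ℕ → Rels.{u}) :
    Option ℕ → ℕ → ZFSet.{u} → ZFSet.{u} → Prop
  | none, k, _, x => [x] ∈ w (k + 2) ∧ GoodC K (w (k + 2))
  | some l, _, a, x => Em K (w (l + 2)) x a

theorem FD.mb {H : ZFSet.{u} → (ℕ → Rels.{u}) → Prop} (r : Option ℕ) (k i : ℕ) :
    FD H (fun K v w => mb K w r k (v k) (v i)) := by
  cases r with
  | none => exact ((FD.svar (k + 2) [i]).and (FD.goodC (k + 2)))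
  | some l => exact FD.em (l + 2) i k

theorem mem_vl {K : ZFSet.{u}} (hK : KN K) (w : ℕ → Rels.{u}) (r : Option ℕ) (k : ℕ)
    (a z : ZFSet.{u}) : z ∈ vl K w r k a ↔
      ∃ x ∈ K, mb K w r k a x ∧ col K (w (lv r k + 2)) x = z := by
  cases r with
  | none => exact mem_top _ _
  | some l =>
    simp only [vl, mb, lv, Option.getD_some]
    rw [mem_col hK]
    constructor
    · rintro ⟨x, h1, h2⟩
      exact ⟨x, h1.1, h1, h2⟩
    · rintro ⟨x, -, h1, h2⟩
      exact ⟨x, h1, h2⟩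

theorem vl_eq {K : ZFSet.{u}} (hK : KN K) {N : ℕ} {w : ℕ → Rels.{u}} (hQ : QRec N K w)
    {r s : Option ℕ} {i j : ℕ} (hi : lv r i < N) (hj : lv s j < N) (a b : ZFSet.{u}) :
    vl K w r i a = vl K w s j b ↔
      (∀ x ∈ K, mb K w r i a x → ∃ y ∈ K, mb K w s j b y ∧ QH w (lv r i) (lv s j) x y) ∧
      (∀ y ∈ K, mb K w s j b y → ∃ x ∈ K, mb K w r i a x ∧ QH w (lv r i) (lv s j) x y) := by
  constructor
  · intro h
    constructor
    · intro x hx hm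
      have : col K (w (lv r i + 2)) x ∈ vl K w s j b := by
        rw [← h, mem_vl hK]; exact ⟨x, hx, hm, rfl⟩
      rw [mem_vl hK] at this
      obtain ⟨y, hy, hm', e⟩ := this
      exact ⟨y, hy, hm', (qh_iff hK hQ hi hj x hx y hy).2 e.symm⟩
    · intro y hy hm
      have : col K (w (lv s j + 2)) y ∈ vl K w r i a := by
        rw [h, mem_vl hK]; exact ⟨y, hy, hm, rfl⟩
      rw [mem_vl hK] at this
      obtain ⟨x, hx, hm', e⟩ := this
      exact ⟨x, hx, hm', (qh_iff hK hQ hi hj x hx y hy).2 e⟩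
  · rintro ⟨h1, h2⟩
    ext z
    rw [mem_vl hK, mem_vl hK]
    constructor
    · rintro ⟨x, hx, hm, rfl⟩
      obtain ⟨y, hy, hm', hq⟩ := h1 x hx hm
      exact ⟨y, hy, hm', ((qh_iff hK hQ hi hj x hx y hy).1 hq).symm⟩
    · rintro ⟨y, hy, hm, rfl⟩
      obtain ⟨x, hx, hm', hq⟩ := h2 y hy hm
      exact ⟨x, hx, hm', (qh_iff hK hQ hi hj x hx y hy).1 hq⟩

/-- side condition -/
def HN (N : ℕ) (K : ZFSet.{u}) (w : ℕ → Rels.{u}) : Prop := KN K ∧ QRec N K w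

theorem FD.vleq {N : ℕ} {r s : Option ℕ} {i j : ℕ} (hi : lv r i < N) (hj : lv s j < N) :
    FD.{u} (HN N) (fun K v w => vl K w r i (v i) = vl K w s j (v j)) := by
  have h1 := ((FD.mb (H := HN.{u} N) r i (i + j + 1)).imp
    (((FD.mb s j (i + j + 2)).and
      (FD.qh (lv r i) (lv s j) (i + j + 1) (i + j + 2))).ex (i + j + 2))).all (i + j + 1)
  have h2 := ((FD.mb (H := HN.{u} N) s j (i + j + 2)).imp
    (((FD.mb r i (i + j + 1)).and
      (FD.qh (lv r i) (lv s j) (i + j + 1) (i + j + 2))).ex (i + j + 1))).all (i + j + 2)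
  refine (h1.and h2).congr (fun K v w hH _ => ?_)
  rw [vl_eq hH.1 hH.2 hi hj]
  have n1 : i ≠ i + j + 1 := by omega
  have n2 : i ≠ i + j + 2 := by omega
  have n3 : j ≠ i + j + 1 := by omega
  have n4 : j ≠ i + j + 2 := by omega
  have n5 : i + j + 1 ≠ i + j + 2 := by omega
  simp only [Function.update_of_ne n1, Function.update_of_ne n2, Function.update_of_ne n3,
    Function.update_of_ne n4, Function.update_of_ne n5, Function.update_of_ne n5.symm,
    Function.update_self]

theorem FD.vlmem {N : ℕ} {r s : Option ℕ} {i j : ℕ} (hi : lv r i < N) (hj : lv s j < N) :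
    FD.{u} (HN N) (fun K v w => vl K w r i (v i) ∈ vl K w s j (v j)) := by
  have h1 := ((FD.mb (H := HN.{u} N) s j (i + j + 1)).and
    (FD.vleq (r := r) (s := some (lv s j)) (i := i) (j := i + j + 1) hi hj)).ex (i + j + 1)
  refine h1.congr (fun K v w hH _ => ?_)
  rw [mem_vl hH.1]
  have n1 : i ≠ i + j + 1 := by omega
  have n3 : j ≠ i + j + 1 := by omega
  simp only [Function.update_of_ne n1, Function.update_of_ne n3, Function.update_self, vl]
  refine exists_congr fun x => and_congr_right fun _ => and_congr_right fun _ => ?_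
  exact eq_comm

theorem delta_tr {φ : SF} (h : IsDeltaZero φ) : ∃ N0, ∀ N, N0 ≤ N → ∀ ρ : ℕ → Option ℕ,
    (∀ k < N0, lv (ρ k) k < N) →
    FD.{u} (HN N) (fun K v w => SatIn ∅ (HS K) φ (fun k => vl K w (ρ k) k (v k))) := by
  induction h with
  | mem i j =>
    exact ⟨i + j + 1, fun N _ ρ hρ => FD.vlmem (hρ i (by omega)) (hρ j (by omega))⟩
  | eq i j =>
    exact ⟨i + j + 1, fun N _ ρ hρ => FD.vleq (hρ i (by omega)) (hρ j (by omega))⟩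
  | pred i =>
    exact ⟨0, fun N _ ρ hρ => FD.false.congr (fun _ _ _ _ _ => by simp [SatIn, Sat])⟩
  | not _ ih =>
    obtain ⟨N0, ih⟩ := ih
    exact ⟨N0, fun N hN ρ hρ => (ih N hN ρ hρ).not⟩
  | and _ _ ih1 ih2 =>
    obtain ⟨N1, ih1⟩ := ih1
    obtain ⟨N2, ih2⟩ := ih2
    exact ⟨max N1 N2, fun N hN ρ hρ =>
      (ih1 N (by omega) ρ (fun k hk => hρ k (by omega))).and
      (ih2 N (by omega) ρ (fun k hk => hρ k (by omega)))⟩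
  | @bex φ k j _ ih =>
    obtain ⟨N1, ih⟩ := ih
    by_cases hkj : k = j
    · subst hkj
      refine ⟨0, fun N _ ρ hρ => FD.false.congr (fun _ _ _ _ _ => ?_)⟩
      simp [SatIn, Sat, ZFSet.mem_irrefl]
    refine ⟨max N1 (k + j + 1), fun N hN ρ hρ => ?_⟩
    have hρ' : ∀ i < N1, lv (Function.update ρ k (some (lv (ρ j) j)) i) i < N := by
      intro i hi
      by_cases hik : i = k
      · subst hik
        simpa [lv] using hρ j (by omega)
      · rw [Function.update_of_ne hik]
        exact hρ i (by omega)
    have h1 := ((FD.mb (H := HN.{u} N) (ρ j) j k).and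
      (ih N (by omega) (Function.update ρ k (some (lv (ρ j) j))) hρ')).ex k
    refine h1.congr (fun K v w hH hv => ?_)
    have hup : ∀ x, (fun i => vl K w (Function.update ρ k (some (lv (ρ j) j)) i) i
        (Function.update v k x i)) =
        Function.update (fun i => vl K w (ρ i) i (v i)) k (col K (w (lv (ρ j) j + 2)) x) := by
      intro x
      funext i
      by_cases hik : i = k
      · subst hik
        simp [vl]
      · simp [hik]
    simp only [hup, SatIn, Sat, Function.update_self, Function.update_of_ne (Ne.symm hkj)]
    constructor
    · rintro ⟨x, hx, hm, hs⟩
      exact ⟨_, col_mem_HS hH.1 _ hx, (mem_vl hH.1 _ _ _ _ _).2 ⟨x, hx, hm, rfl⟩, hs⟩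
    · rintro ⟨y, -, hy, hs⟩
      obtain ⟨x, hx, hm, rfl⟩ := (mem_vl hH.1 _ _ _ _ _).1 hy
      exact ⟨x, hx, hm, hs⟩

/-! ### Second-order formulas: coincidence and closure -/

theorem SO.coinc (D : Set ZFSet.{u}) (I : ℕ → Rels.{u}) (φ : SO) :
    ∀ (v v' : ℕ → ZFSet.{u}) (w w' : ℕ → Rels.{u}), (∀ i ∈ φ.fvF, v i = v' i) →
      (∀ i ∈ φ.fvS, w i = w' i) → (SatSO D I φ v w ↔ SatSO D I φ v' w') := by
  induction φ with
  | mem i j => intro v v' w w' h1 h2; simp [SatSO, h1 i (by simp [SO.fvF]), h1 j (by simp [SO.fvF])]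
  | eq i j => intro v v' w w' h1 h2; simp [SatSO, h1 i (by simp [SO.fvF]), h1 j (by simp [SO.fvF])]
  | rel k l =>
    intro v v' w w' h1 h2
    simp only [SatSO]
    rw [List.map_congr_left h1]
  | svar k l =>
    intro v v' w w' h1 h2
    simp only [SatSO]
    rw [List.map_congr_left h1, h2 k (by simp [SO.fvS])]
  | not φ ih => intro v v' w w' h1 h2; exact not_congr (ih v v' w w' h1 h2)
  | and φ ψ ih1 ih2 =>
    intro v v' w w' h1 h2
    exact and_congr (ih1 v v' w w' (fun i hi => h1 i (Or.inl hi)) (fun i hi => h2 i (Or.inl hi)))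
      (ih2 v v' w w' (fun i hi => h1 i (Or.inr hi)) (fun i hi => h2 i (Or.inr hi)))
  | fex k φ ih =>
    intro v v' w w' h1 h2
    refine exists_congr fun x => and_congr_right fun _ => ih _ _ _ _ (fun i hi => ?_) h2
    by_cases hik : i = k
    · subst hik; simp
    · simpa [hik] using h1 i ⟨hi, hik⟩
  | sall k φ ih =>
    intro v v' w w' h1 h2
    refine forall_congr' fun X => imp_congr_right fun _ => ih _ _ _ _ h1 (fun i hi => ?_)
    by_cases hik : i = k
    · subst hik; simp
    · simpa [hik] using h2 i ⟨hi, hik⟩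

theorem SO.fvF_bdd (φ : SO) : ∃ N, ∀ i ∈ φ.fvF, i < N := by
  have hl : ∀ l : List ℕ, ∃ N, ∀ i ∈ l, i < N := by
    intro l
    induction l with
    | nil => exact ⟨0, by simp⟩
    | cons a l ih =>
      obtain ⟨N, hN⟩ := ih
      refine ⟨max N (a + 1), fun i hi => ?_⟩
      rcases List.mem_cons.1 hi with rfl | h
      · omega
      · have := hN i h; omega
  induction φ with
  | mem i j => exact ⟨i + j + 1, by simp only [SO.fvF]; rintro k (rfl | rfl) <;> omega⟩
  | eq i j => exact ⟨i + j + 1, by simp only [SO.fvF]; rintro k (rfl | rfl) <;> omega⟩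
  | rel k l => exact hl l
  | svar k l => exact hl l
  | not φ ih => exact ih
  | and φ ψ ih1 ih2 =>
    obtain ⟨N1, h1⟩ := ih1
    obtain ⟨N2, h2⟩ := ih2
    refine ⟨max N1 N2, ?_⟩
    rintro i (h | h)
    · have := h1 i h; omega
    · have := h2 i h; omega
  | fex k φ ih =>
    obtain ⟨N, h⟩ := ih
    exact ⟨N, fun i hi => h i hi.1⟩
  | sall k φ ih => exact ih

/-- existential closure of the variables below `N` -/
def exs : ℕ → SO → SO
  | 0, ψ => ψ
  | N + 1, ψ => exs N (.fex N ψ)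

theorem exs_fo (N : ℕ) : ∀ {ψ : SO}, ψ.FO → (exs N ψ).FO := by
  induction N with
  | zero => exact fun h => h
  | succ N ih => exact fun h => ih (.fex N h)

theorem exs_fv (N : ℕ) : ∀ (ψ : SO), (exs N ψ).fvF = {i ∈ ψ.fvF | N ≤ i} := by
  induction N with
  | zero => intro ψ; simp [exs]
  | succ N ih =>
    intro ψ
    simp only [exs, ih, SO.fvF]
    ext i
    simp only [Set.mem_ofPred_eq, Set.mem_sdiff, Set.mem_singleton_iff]
    constructor
    · rintro ⟨⟨h1, h2⟩, h3⟩; exact ⟨h1, by omega⟩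
    · rintro ⟨h1, h2⟩; exact ⟨⟨h1, by omega⟩, by omega⟩

theorem exs_sat (D : Set ZFSet.{u}) (I : ℕ → Rels.{u}) (N : ℕ) : ∀ (ψ : SO) (v : ℕ → ZFSet.{u})
    (w : ℕ → Rels.{u}), SatSO D I (exs N ψ) v w ↔
      ∃ v', (∀ i < N, v' i ∈ D) ∧ (∀ i, N ≤ i → v' i = v i) ∧ SatSO D I ψ v' w := by
  induction N with
  | zero =>
    intro ψ v w
    simp only [exs]
    constructor
    · intro h; exact ⟨v, by simp, by simp, h⟩
    · rintro ⟨v', -, h, h'⟩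
      have : v' = v := funext fun i => h i (by omega)
      exact this ▸ h'
  | succ N ih =>
    intro ψ v w
    simp only [exs, ih, SatSO]
    constructor
    · rintro ⟨v', h1, h2, x, hx, h3⟩
      refine ⟨_, fun i hi => ?_, fun i hi => ?_, h3⟩
      · by_cases hiN : i = N
        · subst hiN; simpa using hx
        · rw [Function.update_of_ne hiN]; exact h1 i (by omega)
      · rw [Function.update_of_ne (by omega)]; exact h2 i (by omega)
    · rintro ⟨v', h1, h2, h3⟩
      refine ⟨Function.update v' N (v N), fun i hi => ?_, fun i hi => ?_, v' N, h1 N (by omega), ?_⟩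
      · rw [Function.update_of_ne (by omega)]; exact h1 i (by omega)
      · by_cases hiN : i = N
        · subst hiN; simp
        · rw [Function.update_of_ne hiN]; exact h2 i (by omega)
      · simpa using h3

theorem closeFO {ψ : SO} (hψ : ψ.FO) : ∃ ψ' : SO, ψ'.FO ∧ ψ'.fvF = ∅ ∧
    ∀ (D : Set ZFSet.{u}) (I : ℕ → Rels.{u}) v w,
      SatSO D I ψ' v w ↔ ∃ v', (∀ i, v' i ∈ D) ∧ SatSO D I ψ v' w := by
  obtain ⟨N, hN⟩ := ψ.fvF_bdd
  refine ⟨exs (N + 1) ψ, exs_fo _ hψ, ?_, fun D I v w => ?_⟩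
  · rw [exs_fv]
    ext i
    simp only [Set.mem_ofPred_eq, Set.mem_empty_iff_false, iff_false]
    rintro ⟨h1, h2⟩
    have := hN i h1
    omega
  · rw [exs_sat]
    constructor
    · rintro ⟨v', h1, -, h3⟩
      refine ⟨fun i => if i < N + 1 then v' i else v' 0, fun i => ?_, ?_⟩
      · dsimp only
        split_ifs with h
        · exact h1 i h
        · exact h1 0 (by omega)
      · refine (SO.coinc D I ψ _ _ _ _ (fun i hi => ?_) (fun _ _ => rfl)).1 h3
        have := hN i hi
        rw [if_pos (by omega)]
    · rintro ⟨v', h1, h3⟩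
      refine ⟨fun i => if i < N + 1 then v' i else v i, fun i hi => ?_, fun i hi => ?_, ?_⟩
      · simp only [if_pos hi]; exact h1 i
      · simp only [if_neg (show ¬ i < N + 1 by omega)]
      · refine (SO.coinc D I ψ _ _ _ _ (fun i hi => ?_) (fun _ _ => rfl)).1 h3
        have := hN i hi
        rw [if_pos (by omega)]

/-! ### Translating set theoretic formulas into second-order formulas -/

def TrS (m : ℕ) (φ : SF) : Prop :=
  ∃ s p : SO, IsSigmaOne (m + 1) s ∧ IsPiOne (m + 1) p ∧ s.fvF = ∅ ∧ p.fvF = ∅ ∧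
    (∀ (K : ZFSet.{u}) I v w, SatSO K.toSet I s v w → Gam K (w 1)) ∧
    (∀ (K : ZFSet.{u}) I v w, SatSO K.toSet I p v w → Gam K (w 1)) ∧
    (∀ (K : ZFSet.{u}) I v w, KN K → (SatSO K.toSet I s v w ↔
      (Gam K (w 1) ∧ SatIn ∅ (HS K) φ (fun k => top K (w (k + 2)))))) ∧
    (∀ (K : ZFSet.{u}) I v w, KN K → (SatSO K.toSet I p v w ↔
      (Gam K (w 1) ∧ ¬ SatIn ∅ (HS K) φ (fun k => top K (w (k + 2))))))

theorem sat_sex (D : Set ZFSet.{u}) (I : ℕ → Rels.{u}) (k : ℕ) (φ : SO) (v w) :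
    SatSO D I (.not (.sall k (.not φ))) v w ↔
      ∃ X : Rels.{u}, (∀ l ∈ X, ∀ x ∈ l, x ∈ D) ∧ SatSO D I φ v (Function.update w k X) := by
  simp only [SatSO]
  push Not
  rfl

theorem TrS_base {φ : SF} (h : IsDeltaZero φ) : TrS.{u} 0 φ := by
  obtain ⟨N0, h0⟩ := delta_tr.{u} h
  obtain ⟨τ, τfo, hτ⟩ := h0 N0 le_rfl (fun _ => none) (fun k hk => hk)
  obtain ⟨γ, γfo, hγ⟩ := FD.gam.{u} (H := fun _ _ => True) 1
  obtain ⟨q, qfo, hq⟩ := FD.qrec.{u} (H := fun _ _ => True) N0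
  obtain ⟨s, sfo, sfv, hs⟩ := closeFO.{u} (SO.FO.and γfo (SO.FO.and qfo τfo))
  obtain ⟨p, pfo, pfv, hp⟩ := closeFO.{u} (SO.FO.and γfo (SO.FO.not (SO.FO.and qfo τfo)))
  refine ⟨.not (.sall 0 (.not s)), .sall 0 p, .sex 0 (.of_pi (.of_fo sfo)),
    .sall 0 (.of_sigma (.of_fo pfo)), sfv, pfv, ?_, ?_, ?_, ?_⟩
  · intro K I v w h
    rw [sat_sex] at h
    obtain ⟨X, hX, h⟩ := h
    obtain ⟨v', hv', h1, -⟩ := (hs _ _ _ _).1 h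
    have h1' := (hγ K I v' _ trivial hv').1 h1
    exact h1'
  · intro K I v w h
    have h := h ∅ (by simp)
    obtain ⟨v', hv', h1, -⟩ := (hp _ _ _ _).1 h
    have h1' := (hγ K I v' _ trivial hv').1 h1
    exact h1'
  · intro K I v w hK
    obtain ⟨a, ha⟩ : ∃ x, x ∈ K := (hK.2 ∅ (by simp)).1
    rw [sat_sex]
    constructor
    · rintro ⟨X, hX, h⟩
      obtain ⟨v', hv', h1, h2, h3⟩ := (hs _ _ _ _).1 h
      have h1' := (hγ K I v' _ trivial hv').1 h1
      refine ⟨h1', ?_⟩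
      have h2' := (hq K I v' _ trivial hv').1 h2
      exact (hτ K I v' _ ⟨hK, h2'⟩ hv').1 h3
    · rintro ⟨h1, h2⟩
      obtain ⟨Q, hQ, hQ'⟩ := exists_Q hK w
      refine ⟨Q, hQ, (hs _ _ _ _).2 ⟨fun _ => a, fun _ => ha, ?_, ?_, ?_⟩⟩
      · exact (hγ K I _ _ trivial fun _ => ha).2 h1
      · exact (hq K I _ _ trivial fun _ => ha).2 (hQ' _)
      · exact (hτ K I _ _ ⟨hK, hQ' _⟩ fun _ => ha).2 h2
  · intro K I v w hK
    obtain ⟨a, ha⟩ : ∃ x, x ∈ K := (hK.2 ∅ (by simp)).1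
    constructor
    · intro h
      obtain ⟨Q, hQ, hQ'⟩ := exists_Q hK w
      obtain ⟨v', hv', h1, h2⟩ := (hp _ _ _ _).1 (h Q hQ)
      have h1' := (hγ K I v' _ trivial hv').1 h1
      refine ⟨h1', fun h3 => h2 ⟨?_, ?_⟩⟩
      · exact (hq K I _ _ trivial hv').2 (hQ' _)
      · exact (hτ K I _ _ ⟨hK, hQ' _⟩ hv').2 h3
    · rintro ⟨h1, h2⟩ Q hQ
      refine (hp _ _ _ _).2 ⟨fun _ => a, fun _ => ha, ?_, ?_⟩
      · exact (hγ K I _ _ trivial fun _ => ha).2 h1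
      · rintro ⟨h3, h4⟩
        have h3' := (hq K I _ _ trivial fun _ => ha).1 h3
        exact h2 ((hτ K I _ _ ⟨hK, h3'⟩ fun _ => ha).1 h4)

theorem TrS_not {m : ℕ} {φ : SF} (h : TrS.{u} m φ) : TrS.{u} (m + 1) (.not φ) := by
  obtain ⟨s, p, h1, h2, h3, h4, h5, h6, h7, h8⟩ := h
  refine ⟨p, s, .of_pi h2, .of_sigma h1, h4, h3, h6, h5, h8, fun K I v w hK => ?_⟩
  rw [h7 K I v w hK]
  simp [SatIn, Sat]

theorem TrS_ex {m : ℕ} {φ : SF} (k : ℕ) (h : TrS.{u} m φ) : TrS.{u} m (.ex k φ) := by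
  obtain ⟨s, p, h1, h2, h3, h4, h5, h6, h7, h8⟩ := h
  have hup : ∀ (K : ZFSet.{u}) (w : ℕ → Rels.{u}) (X : Rels.{u}),
      (fun i => top K (Function.update w (k + 2) X (i + 2))) =
        Function.update (fun i => top K (w (i + 2))) k (top K X) := by
    intro K w X
    funext i
    by_cases hik : i = k
    · subst hik; simp
    · simp [hik]
  have hg : ∀ (w : ℕ → Rels.{u}) (X : Rels.{u}), Function.update w (k + 2) X 1 = w 1 :=
    fun w X => by simp
  refine ⟨.not (.sall (k + 2) (.not s)), .sall (k + 2) p, .sex _ h1, .sall _ h2, h3, h4,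
    ?_, ?_, ?_, ?_⟩
  · intro K I v w h
    rw [sat_sex] at h
    obtain ⟨X, hX, h⟩ := h
    have := h5 _ _ _ _ h
    rwa [hg] at this
  · intro K I v w h
    have := h6 _ _ _ _ (h ∅ (by simp))
    rwa [hg] at this
  · intro K I v w hK
    rw [sat_sex]
    constructor
    · rintro ⟨X, hX, h⟩
      rw [h7 _ _ _ _ hK, hg, hup] at h
      exact ⟨h.1, _, top_mem_HS hK X, h.2⟩
    · rintro ⟨hG, y, hy, h⟩
      obtain ⟨C, hC, rfl⟩ := exists_code hK hy
      refine ⟨C, hC, ?_⟩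
      rw [h7 _ _ _ _ hK, hg, hup]
      exact ⟨hG, h⟩
  · intro K I v w hK
    constructor
    · intro h
      have h' : ∀ X : Rels.{u}, (∀ l ∈ X, ∀ x ∈ l, x ∈ K) → Gam K (w 1) ∧
          ¬ SatIn ∅ (HS K) φ (Function.update (fun i => top K (w (i + 2))) k (top K X)) := by
        intro X hX
        have := h X hX
        rwa [h8 _ _ _ _ hK, hg, hup] at this
      refine ⟨(h' ∅ (by simp)).1, ?_⟩
      rintro ⟨y, hy, h⟩
      obtain ⟨C, hC, rfl⟩ := exists_code hK hy
      exact (h' C hC).2 h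
    · rintro ⟨hG, h⟩ X hX
      rw [h8 _ _ _ _ hK, hg, hup]
      exact ⟨hG, fun h' => h ⟨_, top_mem_HS hK X, h'⟩⟩

mutual
theorem sigma_tr : ∀ {n : ℕ} {φ : SF}, IsSigma n φ → ∀ m, n = m + 1 → TrS.{u} m φ
  | _, _, .of_zero _, _, e => by omega
  | _, _, .of_pi h, m, e => by
    have := pi_tr h
    obtain rfl : _ = m := Nat.succ.inj e
    exact this
  | _, _, .ex k h, m, e => TrS_ex k (sigma_tr h m e)
theorem pi_tr : ∀ {n : ℕ} {φ : SF}, IsPi n φ → TrS.{u} n φ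
  | _, _, .of_zero h => TrS_base h
  | _, _, .not h => TrS_not (sigma_tr h _ rfl)
end

theorem strip : ∀ {n : ℕ} {φ : SF}, IsSigma n φ → ∀ m, n = m + 1 →
    ∃ (ψ : SF) (B : Set ℕ), IsPi m ψ ∧ ∀ (S : Set ZFSet.{u}) (v : ℕ → ZFSet.{u}),
      (SatIn ∅ S φ v ↔ ∃ y, (∀ i ∈ B, y i ∈ S) ∧ (∀ i ∉ B, y i = v i) ∧ SatIn ∅ S ψ y)
  | _, _, .of_zero _, _, e => by omega
  | _, φ, .of_pi h, m, e => by
    obtain rfl : _ = m := Nat.succ.inj e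
    refine ⟨φ, ∅, h, fun S v => ⟨fun h => ⟨v, by simp, by simp, h⟩, ?_⟩⟩
    rintro ⟨y, -, h1, h2⟩
    have : y = v := funext fun i => h1 i (by simp)
    exact this ▸ h2
  | _, _, .ex (φ := φ) k h, m, e => by
    obtain ⟨ψ, B, h1, h2⟩ := strip h m e
    refine ⟨ψ, B ∪ {k}, h1, fun S v => ?_⟩
    have : SatIn ∅ S (.ex k φ) v ↔ ∃ x, x ∈ S ∧ SatIn ∅ S φ (Function.update v k x) := Iff.rfl
    rw [this]
    simp only [h2]
    constructor
    · rintro ⟨x, hx, y, h3, h4, h5⟩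
      refine ⟨y, ?_, ?_, h5⟩
      · intro i hi
        by_cases hB : i ∈ B
        · exact h3 i hB
        · rcases hi with hi | hi
          · exact absurd hi hB
          · obtain rfl : i = k := hi
            rw [h4 i hB]; simpa using hx
      · intro i hi
        simp only [Set.mem_union, Set.mem_singleton_iff, not_or] at hi
        rw [h4 i hi.1, Function.update_of_ne hi.2]
    · rintro ⟨y, h3, h4, h5⟩
      refine ⟨y k, h3 k (by simp), y, fun i hi => h3 i (Or.inl hi), fun i hi => ?_, h5⟩
      by_cases hik : i = k
      · subst hik; simp
      · rw [Function.update_of_ne hik]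
        exact h4 i (by simp [hi, hik])

/-! ### From indescribability to shrewdness -/

def toRel : List ℕ → SO → SO
  | _, .mem i j => .mem i j
  | _, .eq i j => .eq i j
  | _, .rel k l => .rel k l
  | B, .svar k l => if k ∈ B then .svar k l else .rel k l
  | B, .not φ => .not (toRel B φ)
  | B, .and φ ψ => .and (toRel B φ) (toRel B ψ)
  | B, .fex k φ => .fex k (toRel B φ)
  | B, .sall k φ => .sall k (toRel (k :: B) φ)

theorem toRel_fo {φ : SO} (h : φ.FO) : ∀ B, (toRel B φ).FO := by
  induction h with
  | mem i j => exact fun _ => .mem i j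
  | eq i j => exact fun _ => .eq i j
  | rel k l => exact fun _ => .rel k l
  | svar k l =>
    intro B
    simp only [toRel]
    split_ifs
    · exact .svar k l
    · exact .rel k l
  | not _ ih => exact fun B => .not (ih B)
  | and _ _ ih1 ih2 => exact fun B => .and (ih1 B) (ih2 B)
  | fex k _ ih => exact fun B => .fex k (ih B)

mutual
theorem toRel_pi : ∀ {n : ℕ} {φ : SO}, IsPiOne n φ → ∀ B, IsPiOne n (toRel B φ)
  | _, _, .of_fo h, B => .of_fo (toRel_fo h B)
  | _, _, .of_sigma h, B => .of_sigma (toRel_sigma h B)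
  | _, _, .sall k h, B => .sall k (toRel_pi h (k :: B))
theorem toRel_sigma : ∀ {n : ℕ} {φ : SO}, IsSigmaOne n φ → ∀ B, IsSigmaOne n (toRel B φ)
  | _, _, .of_fo h, B => .of_fo (toRel_fo h B)
  | _, _, .of_pi h, B => .of_pi (toRel_pi h B)
  | _, _, .sex k h, B => .sex k (toRel_sigma h (k :: B))
end

theorem toRel_fvF (φ : SO) : ∀ B, (toRel B φ).fvF = φ.fvF := by
  induction φ with
  | svar k l =>
    intro B
    simp only [toRel]
    split_ifs <;> rfl
  | not φ ih => exact ih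
  | and φ ψ ih1 ih2 => intro B; simp only [toRel, SO.fvF, ih1, ih2]
  | fex k φ ih => intro B; simp only [toRel, SO.fvF, ih]
  | sall k φ ih => intro B; simp only [toRel, SO.fvF, ih]
  | _ => intro B; rfl

theorem toRel_fvS (φ : SO) : ∀ B, ∀ i ∈ (toRel B φ).fvS, i ∈ B := by
  induction φ with
  | svar k l =>
    intro B i
    simp only [toRel]
    split_ifs with h
    · rintro rfl; exact h
    · intro h; exact h.elim
  | not φ ih => exact ih
  | and φ ψ ih1 ih2 =>
    rintro B i (h | h)
    · exact ih1 B i h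
    · exact ih2 B i h
  | fex k φ ih => exact ih
  | sall k φ ih =>
    rintro B i ⟨h, h'⟩
    rcases List.mem_cons.1 (ih _ i h) with h | h
    · exact absurd h h'
    · exact h
  | _ => intro B i h; exact h.elim

theorem toRel_sat (D : Set ZFSet.{u}) (I : ℕ → Rels.{u}) (φ : SO) :
    ∀ (B : List ℕ) (v w), SatSO D I (toRel B φ) v w ↔
      SatSO D I φ v (fun k => if k ∈ B then w k else I k) := by
  induction φ with
  | svar k l =>
    intro B v w
    simp only [toRel]
    split_ifs with h <;> simp [SatSO, h]
  | not φ ih => intro B v w; exact not_congr (ih B v w)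
  | and φ ψ ih1 ih2 => intro B v w; exact and_congr (ih1 B v w) (ih2 B v w)
  | fex k φ ih =>
    intro B v w
    exact exists_congr fun x => and_congr_right fun _ => ih B _ w
  | sall k φ ih =>
    intro B v w
    refine forall_congr' fun X => imp_congr_right fun _ => ?_
    rw [ih]
    have : (fun j => if j ∈ k :: B then Function.update w k X j else I j) =
        Function.update (fun j => if j ∈ B then w j else I j) k X := by
      funext j
      by_cases hj : j = k
      · subst hj; simp
      · simp [hj]
    rw [this]
  | _ => intro B v w; exact Iff.rfl

theorem fo_level {φ : SO} (h : φ.FO) (n : ℕ) : IsPiOne n φ ∧ IsSigmaOne n φ := by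
  induction n with
  | zero => exact ⟨.of_fo h, .of_fo h⟩
  | succ n ih => exact ⟨.of_sigma ih.2, .of_pi ih.1⟩

theorem KN_of_ind {n : ℕ} {κ : ZFSet.{u}} (h : WeaklyPiOneIndescribable n κ) : KN κ := by
  obtain ⟨⟨hc, hω⟩, h⟩ := h
  rw [zcard_iff] at hc
  refine ⟨hc.1, fun Z hZ => ⟨⟨∅, hω ZFSet.omega_zero⟩, ?_, ?_⟩⟩
  · rintro ⟨μ, hμ, h1, h2⟩
    refine absurd ?_ (not_le.2 (hc.2 μ hμ))
    have h1' : ∀ x ∈ κ, ∃ y, y ∈ κ ∧ y ∈ μ ∧ [x, y, x, x] ∈ Z := fun x hx => h1 x hx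
    choose! f hf1 hf2 hf3 using h1'
    classical
    refine card_le_of_surj
      (fun y => if h : ∃ x ∈ κ, [x, y, x, x] ∈ Z then h.choose else ∅) (fun z hz => ?_)
    refine ⟨f z, hf2 z hz, ?_⟩
    have hex : ∃ x ∈ κ, [x, f z, x, x] ∈ Z := ⟨z, hz, hf3 z hz⟩
    simp only [dif_pos hex]
    exact h2 _ hex.choose_spec.1 z hz (f z) (hf1 z hz) hex.choose_spec.2 (hf3 z hz)
  · intro hg hne
    by_contra hmin
    push Not at hmin
    let Φ : SO := .and (.fex 0 (.rel 0 [0])) (.not (.fex 0 (.and (.rel 0 [0])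
      (.not (.fex 1 (.and (.rel 0 [1]) (.rel 0 [1, 0])))))))
    have hΦ : Φ.FO := .and (.fex _ (.rel _ _)) (.not (.fex _ (.and (.rel _ _)
      (.not (.fex _ (.and (.rel _ _) (.rel _ _)))))))
    let I : ℕ → Rels.{u} := fun k => if k = 0 then Z else ∅
    have hs : ∀ (K : ZFSet.{u}) (J : ℕ → Rels.{u}), SatSO K.toSet J Φ (fun _ => ∅) (fun _ => ∅) ↔
        (∃ x ∈ K, [x] ∈ J 0) ∧ ∀ x ∈ K, [x] ∈ J 0 → ∃ y ∈ K, [y] ∈ J 0 ∧ [y, x] ∈ J 0 := by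
      intro K J
      simp [Φ, SatSO, mem_toSet_iff]
    obtain ⟨l, hl, hsl⟩ := h Φ I (fo_level hΦ n).1 (by
      constructor
      · ext i; simp [Φ, SO.fvF]; try omega
      · simp [Φ, SO.fvS]) (by
      intro k
      by_cases hk : k = 0
      · simpa [I, hk] using hZ
      · simp [I, hk]) ((hs _ _).2 ⟨by simpa [I] using hne, by simpa [I] using hmin⟩)
    rw [hs] at hsl
    have hlκ : ∀ x ∈ l, x ∈ κ := fun x hx => hc.1.mem_trans hx hl
    obtain ⟨⟨x0, hx0, hx0Z⟩, hs2⟩ := hsl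
    have e1 : ∀ x ∈ l, [x] ∈ restrictRel I l 0 ↔ [x] ∈ Z := by
      intro x hx; simp [restrictRel, I, hx]
    have e2 : ∀ x ∈ l, ∀ y ∈ l, [x, y] ∈ restrictRel I l 0 ↔ [x, y] ∈ Z := by
      intro x hx y hy; simp [restrictRel, I, hx, hy]
    have key : ∀ c : ZFSet.{u}, c ∈ κ → ∀ b ∈ l, [b] ∈ Z → [l, b, c] ∈ Z → False := by
      intro c
      induction c using ZFSet.inductionOn with
      | _ c ih =>
        intro hc b hb hbZ hbc
        obtain ⟨y, hy, hyZ, hyb⟩ := hs2 b hb ((e1 b hb).2 hbZ)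
        obtain ⟨c', hc', hyc⟩ := hg.1 l hl y (hlκ y hy) hy
        refine ih c' ?_ hc' y hy ((e1 y hy).1 hyZ) hyc
        exact hg.2 l hl y (hlκ y hy) b (hlκ b hb) c' hc' c hc hy hb ((e2 y hy b hb).1 hyb) hyc hbc
    obtain ⟨c, hc', hxc⟩ := hg.1 l hl x0 (hlκ x0 hx0) hx0
    exact key c hc' x0 hx0 ((e1 x0 hx0).1 hx0Z) hxc

theorem restrict_idcode {κ l T : ZFSet.{u}} (hκ : κ.IsOrdinal) (hl : l ∈ κ) :
    {L ∈ idcode κ T | ∀ x ∈ L, x ∈ l} = idcode l (T ∩ l) := by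
  have hlκ : ∀ x ∈ l, x ∈ κ := fun x hx => hκ.mem_trans hx hl
  ext L
  simp only [Set.mem_ofPred_eq, idcode, ZFSet.mem_inter]
  constructor
  · rintro ⟨⟨x, hx, rfl⟩ | ⟨x, hx, y, hy, rfl, hxy⟩ | ⟨a, ha, b, hb, rfl⟩, h⟩
    · exact Or.inl ⟨x, ⟨hx, h x (by simp)⟩, rfl⟩
    · exact Or.inr (Or.inl ⟨x, h x (by simp), y, h y (by simp), rfl, hxy⟩)
    · exact Or.inr (Or.inr ⟨a, h a (by simp), b, h b (by simp), rfl⟩)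
  · rintro (⟨x, hx, rfl⟩ | ⟨x, hx, y, hy, rfl, hxy⟩ | ⟨a, ha, b, hb, rfl⟩)
    · exact ⟨Or.inl ⟨x, hx.1, rfl⟩, by simpa using hx.2⟩
    · exact ⟨Or.inr (Or.inl ⟨x, hlκ x hx, y, hlκ y hy, rfl, hxy⟩), by simp [hx, hy]⟩
    · exact ⟨Or.inr (Or.inr ⟨a, hlκ a ha, b, hlκ b hb, rfl⟩), by simp [ha, hb]⟩

theorem ind_to_shrewd {m : ℕ} {κ θ : ZFSet.{u}} (hθ : SuccCardOf θ κ)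
    (h : WeaklyPiOneIndescribable (m + 1) κ) : WeaklyShrewdAt ∅ (m + 2) θ κ := by
  have hK := KN_of_ind h
  obtain ⟨hinf, h⟩ := h
  refine ⟨hinf, hθ.2.1, fun φ A _ hσ hA hsat => ?_⟩
  rw [HSet_eq_HS (succCardOf_card hθ)] at hsat
  obtain ⟨ψ, B, hψ, hst⟩ := strip.{u} hσ (m + 1) rfl
  obtain ⟨y, hy1, hy2, hy3⟩ := (hst _ _).1 hsat
  cases hψ with
  | @not _ σ hσ' =>
  obtain ⟨s, p, -, hp, -, pfv, -, hpG, -, hpS⟩ := sigma_tr.{u} hσ' m rfl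
  have hcodes : ∀ k, ∃ C : Rels.{u}, (k ∈ B → (∀ l ∈ C, ∀ x ∈ l, x ∈ κ) ∧ top κ C = y k) := by
    intro k
    by_cases hk : k ∈ B
    · obtain ⟨C, hC⟩ := exists_code hK (hy1 k hk)
      exact ⟨C, fun _ => hC⟩
    · exact ⟨∅, fun h => absurd h hk⟩
  choose C hC using hcodes
  classical
  let I : ℕ → Rels.{u} := fun j => match j with
    | 0 => ∅
    | 1 => ∅
    | k + 2 => if k ∈ B then C k else idcode κ (val2 A κ k)
  have hsub : ∀ k, val2 A κ k ⊆ κ := by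
    intro k
    unfold val2
    split_ifs
    · exact hA
    · exact fun _ h => h
    · exact ZFSet.empty_subset _
  have hI : ∀ k, ∀ l ∈ I k, ∀ x ∈ l, x ∈ κ := by
    intro k
    match k with
    | 0 => simp [I]
    | 1 => simp [I]
    | k + 2 =>
      simp only [I]
      split_ifs with hk
      · exact (hC k hk).1
      · exact idcode_dom (hsub k)
  have hyI : y = fun k => top κ (I (k + 2)) := by
    funext k
    simp only [I]
    split_ifs with hk
    · exact (hC k hk).2.symm
    · rw [top_idcode hK (hsub k), hy2 k hk]
  have hsatΦ : ∀ (D : Set ZFSet.{u}) (J : ℕ → Rels.{u}),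
      SatSO D J (toRel [] (.sall 1 p)) (fun _ => ∅) (fun _ => ∅) ↔
      ∀ Z : Rels.{u}, (∀ l ∈ Z, ∀ x ∈ l, x ∈ D) →
        SatSO D J p (fun _ => ∅) (Function.update J 1 Z) := by
    intro D J
    rw [toRel_sat]
    simp [SatSO]
  have hup : ∀ (J : ℕ → Rels.{u}) Z k, Function.update J 1 Z (k + 2) = J (k + 2) := by
    intro J Z k
    simp
  obtain ⟨l, hl, hls⟩ := h (toRel [] (.sall 1 p)) I (toRel_pi (.sall 1 hp) _) (by
    constructor
    · rw [toRel_fvF]; exact pfv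
    · ext i
      simp only [Set.mem_empty_iff_false, iff_false]
      intro hi
      simpa using toRel_fvS _ _ i hi) hI (by
    rw [hsatΦ]
    intro Z hZ
    rw [hpS κ _ _ _ hK]
    refine ⟨by simpa using hK.2 Z hZ, ?_⟩
    simp only [hup]
    rw [← hyI]
    exact hy3)
  rw [hsatΦ] at hls
  have hl0 : l.IsOrdinal := hK.1.mem hl
  have hlK : KN l := ⟨hl0, fun Z hZ => by simpa using hpG _ _ _ _ (hls Z hZ)⟩
  refine ⟨l, scard l, hlK.zcard, zcard_scard l, mem_scard hl0, hl, ?_⟩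
  rw [HSet_eq_HS (card_scard l), hst]
  have h1 := ((hpS l _ _ _ hlK).1 (hls ∅ (by simp))).2
  simp only [hup] at h1
  refine ⟨_, fun i _ => top_mem_HS hlK _, fun i hi => ?_, h1⟩
  have e : restrictRel I l (i + 2) = idcode l (val2 (A ∩ l) l i) := by
    simp only [restrictRel, I, if_neg hi]
    rw [restrict_idcode hK.1 hl]
    congr 1
    unfold val2
    split_ifs
    · rfl
    · ext z
      simp only [ZFSet.mem_inter]
      exact ⟨fun h => h.2, fun h => ⟨hK.1.mem_trans h hl, h⟩⟩
    · ext z; simp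
  rw [e, top_idcode hlK]
  unfold val2
  split_ifs
  · intro z hz; exact (ZFSet.mem_inter.1 hz).2
  · exact fun _ h => h
  · exact ZFSet.empty_subset _

/-! ### Pairing of ordinals -/

theorem InfCard.aleph0_le {κ : ZFSet.{u}} (h : InfCard κ) : ℵ₀ ≤ κ.card := by
  have hω : ∀ n : ℕ, ((n : Ordinal.{u}).toZFSet) ∈ ZFSet.omega := by
    intro n
    induction n with
    | zero => simp
    | succ n ih =>
      have := ZFSet.omega_succ ih
      rwa [Nat.cast_succ, Ordinal.toZFSet_add_one]
  rw [← Cardinal.lift_le.{u+1}, ← ZFSet.cardinalMk_coe_sort, Cardinal.lift_aleph0]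
  rw [← Cardinal.lift_le.{0}, Cardinal.lift_aleph0]
  have := Cardinal.mk_le_of_injective (α := ULift.{u+1} ℕ) (β := κ)
    (f := fun n => ⟨((n.down : Ordinal.{u}).toZFSet), h.2 (hω _)⟩) (by
      intro a b hab
      have := Ordinal.toZFSet_injective (congrArg Subtype.val hab)
      exact ULift.ext _ _ (by exact_mod_cast this))
  simpa using this

theorem card_prod_le (x y : ZFSet.{u}) : (ZFSet.prod x y).card ≤ x.card * y.card := by
  rw [← Cardinal.lift_le.{u+1}, Cardinal.lift_mul, ← ZFSet.cardinalMk_coe_sort,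
    ← ZFSet.cardinalMk_coe_sort, ← ZFSet.cardinalMk_coe_sort]
  have h : ∀ z : ZFSet.prod x y, ∃ a : x, ∃ b : y, z.1 = ZFSet.pair a.1 b.1 := by
    rintro ⟨z, hz⟩
    obtain ⟨a, ha, b, hb, rfl⟩ := ZFSet.mem_prod.1 hz
    exact ⟨⟨a, ha⟩, ⟨b, hb⟩, rfl⟩
  choose a b hab using h
  rw [Cardinal.mul_def]
  refine Cardinal.mk_le_of_injective (f := fun z => (a z, b z)) ?_
  intro z z' hz
  simp only [Prod.mk.injEq] at hz
  exact Subtype.ext (by rw [hab z, hab z', hz.1, hz.2])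

theorem HS_closed {κ X : ZFSet.{u}} (hκ : ℵ₀ ≤ κ.card) (hX : X.card ≤ κ.card)
    (h : ∀ x ∈ X, x ∈ HS κ) : X ∈ HS κ := by
  choose! t ht1 ht2 ht3 using h
  refine ⟨X ∪ ZFSet.iUnion (fun x : X => t x.1), ?_, ?_, ?_⟩
  · intro y hy z hz
    rw [ZFSet.mem_union] at hy ⊢
    right
    rw [ZFSet.mem_iUnion] at hy ⊢
    rcases hy with hy | ⟨x, hx⟩
    · exact ⟨⟨y, hy⟩, ht2 y hy hz⟩
    · exact ⟨x, ht1 x.1 x.2 y hx hz⟩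
  · intro y hy
    exact ZFSet.mem_union.2 (Or.inl hy)
  · refine ZFSet.card_union_le.trans ((add_le_add hX ?_).trans_eq (Cardinal.add_eq_self hκ))
    rw [← Cardinal.lift_le.{u+1}]
    refine ZFSet.lift_card_iUnion_le_sum_card.trans ?_
    refine (Cardinal.sum_le_sum (fun i : X => (t i.1).card) (fun _ => κ.card) (fun i => ht3 i.1 i.2)).trans ?_
    rw [Cardinal.sum_const, ZFSet.cardinalMk_coe_sort, Cardinal.lift_lift, ← Cardinal.lift_mul]
    rw [Cardinal.lift_le]
    exact (mul_le_mul_left hX _).trans_eq (Cardinal.mul_eq_self hκ)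

theorem HS_sub {κ X : ZFSet.{u}} (hκ : κ.IsTransitive) (hX : X ⊆ κ) : X ∈ HS κ :=
  ⟨κ, hκ, hX, le_rfl⟩

theorem HS_pair {κ x y : ZFSet.{u}} (hκ : ℵ₀ ≤ κ.card) (hx : x ∈ HS κ) (hy : y ∈ HS κ) :
    ZFSet.pair x y ∈ HS κ := by
  have hp : ∀ x y, x ∈ HS κ → y ∈ HS κ → ({x, y} : ZFSet.{u}) ∈ HS κ := by
    intro x y hx hy
    refine HS_closed hκ ?_ ?_
    · refine ZFSet.card_insert_le.trans ?_
      rw [ZFSet.card_singleton]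
      refine le_trans ?_ hκ
      exact (Cardinal.add_lt_aleph0 Cardinal.one_lt_aleph0 Cardinal.one_lt_aleph0).le
    · intro z hz
      rcases ZFSet.mem_pair.1 hz with rfl | rfl <;> assumption
  have h1 : ({x} : ZFSet.{u}) = {x, x} := by ext z; simp
  unfold ZFSet.pair
  refine hp _ _ ?_ (hp _ _ hx hy)
  rw [h1]
  exact hp _ _ hx hx

/-- sorting key for pairs of ordinals -/
noncomputable def gkey (p : ZFSet.{u} × ZFSet.{u}) :
    Lex (Ordinal.{u} × Lex (Ordinal.{u} × Ordinal.{u})) :=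
  toLex (max p.1.rank p.2.rank, toLex (p.1.rank, p.2.rank))

def grel (q p : ZFSet.{u} × ZFSet.{u}) : Prop :=
  (q.1.IsOrdinal ∧ q.2.IsOrdinal ∧ p.1.IsOrdinal ∧ p.2.IsOrdinal) ∧ gkey q < gkey p

theorem grel_wf : WellFounded grel.{u} :=
  Subrelation.wf (r := InvImage (· < ·) gkey.{u}) (fun h => h.2)
    (InvImage.wf _ wellFounded_lt)

theorem gkey_lt {q p : ZFSet.{u} × ZFSet.{u}} : gkey q < gkey p ↔
    max q.1.rank q.2.rank < max p.1.rank p.2.rank ∨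
    (max q.1.rank q.2.rank = max p.1.rank p.2.rank ∧
      (q.1.rank < p.1.rank ∨ (q.1.rank = p.1.rank ∧ q.2.rank < p.2.rank))) := by
  unfold gkey
  rw [Prod.Lex.toLex_lt_toLex, Prod.Lex.toLex_lt_toLex]

def gbd (p : ZFSet.{u} × ZFSet.{u}) : ZFSet.{u} := insert p.1 p.1 ∪ insert p.2 p.2

theorem grel_bd {q p : ZFSet.{u} × ZFSet.{u}} (h : grel q p) : q.1 ∈ gbd p ∧ q.2 ∈ gbd p := by
  obtain ⟨⟨h1, h2, h3, h4⟩, h⟩ := h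
  have hle : max q.1.rank q.2.rank ≤ max p.1.rank p.2.rank := by
    rcases gkey_lt.1 h with h | h
    · exact h.le
    · exact h.1.le
  have key : ∀ a : ZFSet.{u}, a.IsOrdinal → a.rank ≤ max p.1.rank p.2.rank → a ∈ gbd p := by
    intro a ha hr
    simp only [gbd, ZFSet.mem_union, ZFSet.mem_insert_iff]
    rcases le_max_iff.1 hr with hr | hr
    · left
      rcases hr.eq_or_lt with hr | hr
      · exact Or.inl ((ZFSet.IsOrdinal.rank_inj ha h3).1 hr)
      · exact Or.inr ((ZFSet.IsOrdinal.rank_lt_iff_mem ha h3).1 hr)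
    · right
      rcases hr.eq_or_lt with hr | hr
      · exact Or.inl ((ZFSet.IsOrdinal.rank_inj ha h4).1 hr)
      · exact Or.inr ((ZFSet.IsOrdinal.rank_lt_iff_mem ha h4).1 hr)
  exact ⟨key _ h1 ((le_max_left _ _).trans hle), key _ h2 ((le_max_right _ _).trans hle)⟩

theorem grel_small (p : ZFSet.{u} × ZFSet.{u}) : Small.{u} {q // grel q p} :=
  small_of_injective (β := gbd p × gbd p)
    (f := fun q => (⟨q.1.1, (grel_bd q.2).1⟩, ⟨q.1.2, (grel_bd q.2).2⟩))
    (fun q q' h => by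
      simp only [Prod.mk.injEq, Subtype.mk.injEq] at h
      exact Subtype.ext (Prod.ext h.1 h.2))

/-- the pairing function on ordinals -/
noncomputable def gg : ZFSet.{u} × ZFSet.{u} → ZFSet.{u} :=
  (exists_coll grel.{u} grel_wf grel_small {∅}).choose

theorem mem_gg (p : ZFSet.{u} × ZFSet.{u}) (z : ZFSet.{u}) :
    z ∈ gg p ↔ z = ∅ ∨ ∃ q, grel q p ∧ gg q = z := by
  have := (exists_coll grel.{u} grel_wf grel_small {∅}).choose_spec p z
  rw [ZFSet.mem_singleton] at this
  exact this

theorem gg_ne (p : ZFSet.{u} × ZFSet.{u}) : gg p ≠ ∅ := by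
  intro h
  have : (∅ : ZFSet.{u}) ∈ gg p := (mem_gg _ _).2 (Or.inl rfl)
  rw [h] at this
  exact ZFSet.notMem_empty _ this

theorem gg_inj {p q : ZFSet.{u} × ZFSet.{u}} (h1 : p.1.IsOrdinal) (h2 : p.2.IsOrdinal)
    (h3 : q.1.IsOrdinal) (h4 : q.2.IsOrdinal) (h : gg p = gg q) : p = q := by
  rcases lt_trichotomy (gkey p) (gkey q) with hk | hk | hk
  · have : gg p ∈ gg q := (mem_gg _ _).2 (Or.inr ⟨p, ⟨⟨h1, h2, h3, h4⟩, hk⟩, rfl⟩)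
    rw [h] at this
    exact absurd this (ZFSet.mem_irrefl _)
  · unfold gkey at hk
    have hk := toLex.injective hk
    simp only [Prod.mk.injEq] at hk
    have hk2 := toLex.injective hk.2
    simp only [Prod.mk.injEq] at hk2
    exact Prod.ext ((ZFSet.IsOrdinal.rank_inj h1 h3).1 hk2.1)
      ((ZFSet.IsOrdinal.rank_inj h2 h4).1 hk2.2)
  · have : gg q ∈ gg p := (mem_gg _ _).2 (Or.inr ⟨q, ⟨⟨h3, h4, h1, h2⟩, hk⟩, rfl⟩)
    rw [h] at this
    exact absurd this (ZFSet.mem_irrefl _)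

theorem gg_trans (p : ZFSet.{u} × ZFSet.{u}) : (gg p).IsTransitive := by
  intro y hy z hz
  rcases (mem_gg _ _).1 hy with rfl | ⟨q, hq, rfl⟩
  · exact absurd hz (ZFSet.notMem_empty _)
  · rcases (mem_gg _ _).1 hz with rfl | ⟨r, hr, rfl⟩
    · exact (mem_gg _ _).2 (Or.inl rfl)
    · exact (mem_gg _ _).2 (Or.inr ⟨r, ⟨⟨hr.1.1, hr.1.2.1, hq.1.2.2⟩, hr.2.trans hq.2⟩, rfl⟩)

theorem gg_ord (p : ZFSet.{u} × ZFSet.{u}) : (gg p).IsOrdinal := by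
  refine ZFSet.isOrdinal_iff_forall_mem_isTransitive.2 ⟨gg_trans p, fun y hy => ?_⟩
  rcases (mem_gg _ _).1 hy with rfl | ⟨q, hq, rfl⟩
  · exact ZFSet.isTransitive_empty
  · exact gg_trans q

theorem gg_mem {κ : ZFSet.{u}} (h : InfCard κ) {x z : ZFSet.{u}} (hx : x ∈ κ) (hz : z ∈ κ) :
    gg (x, z) ∈ κ := by
  have h0 := h.aleph0_le
  have hc := zcard_iff.1 h.1
  refine mem_of_card_lt (gg_ord _) hc.1 ?_
  have hi : ∀ a ∈ κ, (insert a a : ZFSet.{u}).card < κ.card := fun a ha =>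
    ZFSet.card_insert_le.trans_lt (Cardinal.add_lt_of_lt h0 (hc.2 a ha)
      (Cardinal.one_lt_aleph0.trans_le h0))
  have hb : (gbd (x, z)).card < κ.card :=
    ZFSet.card_union_le.trans_lt (Cardinal.add_lt_of_lt h0 (hi x hx) (hi z hz))
  have hp : (insert ∅ (ZFSet.prod (gbd (x, z)) (gbd (x, z)))).card < κ.card :=
    ZFSet.card_insert_le.trans_lt (Cardinal.add_lt_of_lt h0
      ((card_prod_le _ _).trans_lt (Cardinal.mul_lt_of_lt h0 hb hb))
      (Cardinal.one_lt_aleph0.trans_le h0))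
  refine lt_of_le_of_lt ?_ hp
  classical
  refine card_le_of_surj (fun a => if h : ∃ q : ZFSet.{u} × ZFSet.{u}, a = ZFSet.pair q.1 q.2
    then gg h.choose else ∅) (fun y hy => ?_)
  rcases (mem_gg _ _).1 hy with rfl | ⟨q, hq, rfl⟩
  · refine ⟨∅, ZFSet.mem_insert_iff.2 (Or.inl rfl), ?_⟩
    rw [dif_neg]
    rintro ⟨q, hq⟩
    have : ({q.1} : ZFSet.{u}) ∈ ZFSet.pair q.1 q.2 := by simp [ZFSet.pair]
    rw [← hq] at this
    exact ZFSet.notMem_empty _ this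
  · refine ⟨ZFSet.pair q.1 q.2, ZFSet.mem_insert_iff.2 (Or.inr
      (ZFSet.pair_mem_prod.2 (grel_bd hq))), ?_⟩
    have hex : ∃ q' : ZFSet.{u} × ZFSet.{u}, ZFSet.pair q.1 q.2 = ZFSet.pair q'.1 q'.2 := ⟨q, rfl⟩
    rw [dif_pos hex]
    have := ZFSet.pair_inj.1 hex.choose_spec
    exact congrArg gg (Prod.ext this.1.symm this.2.symm)

/-- codes of lists -/
noncomputable def enc : List ZFSet.{u} → ZFSet.{u}
  | [] => ∅
  | x :: L => gg (x, enc L)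

theorem enc_ord (L : List ZFSet.{u}) : (enc L).IsOrdinal := by
  cases L with
  | nil => exact ZFSet.isOrdinal_empty
  | cons x L => exact gg_ord _

theorem enc_inj : ∀ (L L' : List ZFSet.{u}), (∀ x ∈ L, x.IsOrdinal) → (∀ x ∈ L', x.IsOrdinal) →
    enc L = enc L' → L = L'
  | [], [], _, _, _ => rfl
  | [], _ :: _, _, _, h => absurd h.symm (gg_ne _)
  | _ :: _, [], _, _, h => absurd h (gg_ne _)
  | x :: L, x' :: L', h1, h2, h => by
    have := gg_inj (h1 x (by simp)) (enc_ord L) (h2 x' (by simp)) (enc_ord L') h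
    simp only [Prod.mk.injEq] at this
    rw [this.1, enc_inj L L' (fun y hy => h1 y (by simp [hy])) (fun y hy => h2 y (by simp [hy]))
      this.2]

/-- the order on pairs, in a simple form -/
def PL (x' z' x z : ZFSet.{u}) : Prop :=
  ((x' ∈ x ∨ x' ∈ z) ∧ (z' ∈ x ∨ z' ∈ z)) ∨
  (¬ ((x ∈ x' ∨ x ∈ z') ∧ (z ∈ x' ∨ z ∈ z')) ∧ (x' ∈ x ∨ (x' = x ∧ z' ∈ z)))

theorem PL_iff {x' z' x z : ZFSet.{u}} (h1 : x'.IsOrdinal) (h2 : z'.IsOrdinal)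
    (h3 : x.IsOrdinal) (h4 : z.IsOrdinal) : PL x' z' x z ↔ grel (x', z') (x, z) := by
  unfold PL grel
  rw [gkey_lt]
  simp only [h1, h2, h3, h4, true_and]
  rw [← ZFSet.IsOrdinal.rank_lt_iff_mem h1 h3, ← ZFSet.IsOrdinal.rank_lt_iff_mem h1 h4,
    ← ZFSet.IsOrdinal.rank_lt_iff_mem h2 h3, ← ZFSet.IsOrdinal.rank_lt_iff_mem h2 h4,
    ← ZFSet.IsOrdinal.rank_lt_iff_mem h3 h1, ← ZFSet.IsOrdinal.rank_lt_iff_mem h3 h2,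
    ← ZFSet.IsOrdinal.rank_lt_iff_mem h4 h1, ← ZFSet.IsOrdinal.rank_lt_iff_mem h4 h2,
    ← ZFSet.IsOrdinal.rank_inj h1 h3]
  simp only [← lt_max_iff, ← max_lt_iff]
  set a := max x'.rank z'.rank
  set b := max x.rank z.rank
  constructor
  · rintro (h | ⟨h, h'⟩)
    · exact Or.inl h
    · rcases lt_trichotomy a b with h5 | h5 | h5
      · exact Or.inl h5
      · exact Or.inr ⟨h5, h'⟩
      · exact absurd h5 h
  · rintro (h | ⟨h, h'⟩)
    · exact Or.inl h
    · exact Or.inr ⟨h ▸ lt_irrefl _, h'⟩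

/-! ### Bounded definability -/

theorem delta_ren {φ : SF} (h : IsDeltaZero φ) : ∃ N, ∀ (k0 : ℕ) (f : ℕ → ℕ),
    (∀ i, i < N → f i < k0) → ∃ φ', IsDeltaZero φ' ∧ ∀ (S : Set ZFSet.{u}) (v w : ℕ → ZFSet.{u}),
      (∀ i, i < N → w i = v (f i)) → (SatIn ∅ S φ' v ↔ SatIn ∅ S φ w) := by
  induction h with
  | mem i j =>
    refine ⟨i + j + 1, fun k0 f _ => ⟨.mem (f i) (f j), .mem _ _, fun S v w hw => ?_⟩⟩
    simp only [SatIn, Sat, hw i (by omega), hw j (by omega)]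
  | eq i j =>
    refine ⟨i + j + 1, fun k0 f _ => ⟨.eq (f i) (f j), .eq _ _, fun S v w hw => ?_⟩⟩
    simp only [SatIn, Sat, hw i (by omega), hw j (by omega)]
  | pred i =>
    refine ⟨i + 1, fun k0 f _ => ⟨.pred (f i), .pred _, fun S v w hw => ?_⟩⟩
    simp only [SatIn, Sat, hw i (by omega)]
  | not _ ih =>
    obtain ⟨N, hN⟩ := ih
    refine ⟨N, fun k0 f hf => ?_⟩
    obtain ⟨φ', h1, h2⟩ := hN k0 f hf
    exact ⟨.not φ', .not h1, fun S v w hw => not_congr (h2 S v w hw)⟩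
  | and _ _ ih1 ih2 =>
    obtain ⟨N, hN⟩ := ih1
    obtain ⟨M, hM⟩ := ih2
    refine ⟨N + M, fun k0 f hf => ?_⟩
    obtain ⟨φ', h1, h2⟩ := hN k0 f (fun i hi => hf i (by omega))
    obtain ⟨ψ', h3, h4⟩ := hM k0 f (fun i hi => hf i (by omega))
    exact ⟨.and φ' ψ', .and h1 h3, fun S v w hw => and_congr
      (h2 S v w (fun i hi => hw i (by omega))) (h4 S v w (fun i hi => hw i (by omega)))⟩
  | bex k j _ ih =>
    obtain ⟨N, hN⟩ := ih
    refine ⟨N + k + j + 1, fun k0 f hf => ?_⟩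
    by_cases hkj : k = j
    · subst hkj
      refine ⟨.not (.eq 0 0), .not (.eq _ _), fun S v w hw => ?_⟩
      simp only [SatIn, Sat, not_true_eq_false, false_iff]
      rintro ⟨x, hx, h1, h2⟩
      exact ZFSet.mem_irrefl _ h1
    · obtain ⟨φ', h1, h2⟩ := hN (k0 + 1) (Function.update f k k0) (fun i hi => by
        by_cases hik : i = k
        · subst hik
          simp
        · rw [Function.update_of_ne hik]
          exact (hf i (by omega)).trans (Nat.lt_succ_self _))
      refine ⟨.ex k0 (.and (.mem k0 (f j)) φ'), .bex _ _ h1, fun S v w hw => ?_⟩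
      have hj := hf j (by omega)
      simp only [SatIn, Sat]
      refine exists_congr fun x => and_congr_right fun hx => and_congr ?_ ?_
      · simp [Function.update_of_ne (Ne.symm hkj), Function.update_of_ne hj.ne, hw j (by omega)]
      · refine h2 S _ _ (fun i hi => ?_)
        by_cases hik : i = k
        · subst hik
          simp
        · rw [Function.update_of_ne hik, Function.update_of_ne hik,
            Function.update_of_ne (hf i (by omega)).ne, hw i (by omega)]

def vcons (x : ZFSet.{u}) (v : ℕ → ZFSet.{u}) : ℕ → ZFSet.{u}
  | 0 => x
  | i + 1 => v i

/-- predicates defined by bounded formulas -/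
def DD (P : (ℕ → ZFSet.{u}) → Prop) : Prop :=
  ∃ φ, IsDeltaZero φ ∧ ∀ S : Set ZFSet.{u}, (∀ x ∈ S, ∀ y ∈ x, y ∈ S) →
    ∀ v : ℕ → ZFSet.{u}, (∀ i, v i ∈ S) → (SatIn ∅ S φ v ↔ P v)

namespace DD

variable {P Q : (ℕ → ZFSet.{u}) → Prop}

theorem congr (h : DD P) (hPQ : ∀ v, P v ↔ Q v) : DD Q := by
  obtain ⟨φ, h1, h2⟩ := h
  exact ⟨φ, h1, fun S hS v hv => (h2 S hS v hv).trans (hPQ v)⟩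

theorem mem (i j : ℕ) : DD.{u} (fun v => v i ∈ v j) := ⟨.mem i j, .mem _ _, fun _ _ _ _ => Iff.rfl⟩

theorem eq (i j : ℕ) : DD.{u} (fun v => v i = v j) := ⟨.eq i j, .eq _ _, fun _ _ _ _ => Iff.rfl⟩

theorem not (h : DD P) : DD (fun v => ¬ P v) := by
  obtain ⟨φ, h1, h2⟩ := h
  exact ⟨.not φ, .not h1, fun S hS v hv => not_congr (h2 S hS v hv)⟩

theorem and (h : DD P) (h' : DD Q) : DD (fun v => P v ∧ Q v) := by
  obtain ⟨φ, h1, h2⟩ := h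
  obtain ⟨ψ, h3, h4⟩ := h'
  exact ⟨.and φ ψ, .and h1 h3, fun S hS v hv => and_congr (h2 S hS v hv) (h4 S hS v hv)⟩

theorem imp (h : DD P) (h' : DD Q) : DD (fun v => P v → Q v) :=
  (h.and h'.not).not.congr (fun v => by tauto)

theorem or (h : DD P) (h' : DD Q) : DD (fun v => P v ∨ Q v) :=
  (h.not.and h'.not).not.congr (fun v => by tauto)

theorem false : DD.{u} (fun _ => False) := (eq 0 0).not.congr (fun v => by simp)

theorem bexU (k j : ℕ) (hkj : k ≠ j) (h : DD P) :
    DD (fun v => ∃ x ∈ v j, P (Function.update v k x)) := by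
  obtain ⟨φ, h1, h2⟩ := h
  refine ⟨.ex k (.and (.mem k j) φ), .bex _ _ h1, fun S hS v hv => ?_⟩
  simp only [SatIn, Sat, Function.update_self, Function.update_of_ne (Ne.symm hkj)]
  constructor
  · rintro ⟨x, hx, hxj, hφ⟩
    exact ⟨x, hxj, (h2 S hS _ (fun i => by
      by_cases hik : i = k
      · subst hik; simpa using hx
      · rw [Function.update_of_ne hik]; exact hv i)).1 hφ⟩
  · rintro ⟨x, hxj, hφ⟩
    have hx := hS _ (hv j) x hxj
    exact ⟨x, hx, hxj, (h2 S hS _ (fun i => by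
      by_cases hik : i = k
      · subst hik; simpa using hx
      · rw [Function.update_of_ne hik]; exact hv i)).2 hφ⟩

theorem bex {j : ℕ} {R : (ℕ → ZFSet.{u}) → ZFSet.{u} → Prop}
    (h : DD (fun v => R (fun i => v (i + 1)) (v 0))) : DD (fun v => ∃ x ∈ v j, R v x) := by
  obtain ⟨φ, h1, h2⟩ := h
  obtain ⟨N, hN⟩ := delta_ren.{u} h1
  obtain ⟨φ', h3, h4⟩ := hN (N + j + 2) (fun i => i.casesOn (N + j + 1) (fun i => i)) (by
    intro i hi
    cases i with
    | zero => simp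
    | succ i => simp only; omega)
  refine ⟨.ex (N + j + 1) (.and (.mem (N + j + 1) j) φ'), .bex _ _ h3, fun S hS v hv => ?_⟩
  simp only [SatIn, Sat, Function.update_self,
    Function.update_of_ne (show j ≠ N + j + 1 by omega)]
  have key : ∀ x ∈ S, (SatIn ∅ S φ' (Function.update v (N + j + 1) x) ↔ R v x) := by
    intro x hx
    rw [h4 S _ (vcons x v) (by
      intro i hi
      cases i with
      | zero => simp [vcons]
      | succ i => simp only [vcons]; rw [Function.update_of_ne (by omega)])]
    refine h2 S hS (vcons x v) ?_
    intro i
    cases i with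
    | zero => exact hx
    | succ i => exact hv i
  constructor
  · rintro ⟨x, hx, hxj, hφ⟩
    exact ⟨x, hxj, (key x hx).1 hφ⟩
  · rintro ⟨x, hxj, hφ⟩
    have hx := hS _ (hv j) x hxj
    exact ⟨x, hx, hxj, (key x hx).2 hφ⟩

theorem ball {j : ℕ} {R : (ℕ → ZFSet.{u}) → ZFSet.{u} → Prop}
    (h : DD (fun v => R (fun i => v (i + 1)) (v 0))) : DD (fun v => ∀ x ∈ v j, R v x) :=
  (DD.bex (j := j) (R := fun v x => ¬ R v x) h.not).not.congr (fun v => by push Not; rfl)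

end DD

def Emp (x : ZFSet.{u}) : Prop := ∀ t ∈ x, False

theorem emp_iff {x : ZFSet.{u}} : Emp x ↔ x = ∅ := by
  unfold Emp
  rw [ZFSet.eq_empty]

theorem DD.emp (i : ℕ) : DD.{u} (fun v => Emp (v i)) := by
  unfold Emp
  exact DD.ball DD.false

def UP (a x y : ZFSet.{u}) : Prop := x ∈ a ∧ y ∈ a ∧ ∀ t ∈ a, t = x ∨ t = y

theorem up_iff {a x y : ZFSet.{u}} : UP a x y ↔ a = {x, y} := by
  constructor
  · rintro ⟨h1, h2, h3⟩
    ext t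
    rw [ZFSet.mem_pair]
    refine ⟨h3 t, ?_⟩
    rintro (rfl | rfl) <;> assumption
  · rintro rfl
    exact ⟨by simp, by simp, fun t ht => ZFSet.mem_pair.1 ht⟩

theorem DD.up (i j k : ℕ) : DD.{u} (fun v => UP (v i) (v j) (v k)) := by
  unfold UP
  exact (DD.mem _ _).and ((DD.mem _ _).and (DD.ball ((DD.eq _ _).or (DD.eq _ _))))

def OP (p x y : ZFSet.{u}) : Prop :=
  (∃ s ∈ p, UP s x x) ∧ (∃ s ∈ p, UP s x y) ∧ ∀ s ∈ p, UP s x x ∨ UP s x y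

theorem op_iff {p x y : ZFSet.{u}} : OP p x y ↔ p = ZFSet.pair x y := by
  have h1 : ({x} : ZFSet.{u}) = {x, x} := by ext z; simp
  unfold OP ZFSet.pair
  simp only [up_iff, exists_eq_right]
  rw [← h1, ← up_iff]
  rfl

theorem DD.op (i j k : ℕ) : DD.{u} (fun v => OP (v i) (v j) (v k)) := by
  unfold OP
  exact (DD.bex (DD.up _ _ _)).and ((DD.bex (DD.up _ _ _)).and
    (DD.ball ((DD.up _ _ _).or (DD.up _ _ _))))

def TT (G x z y : ZFSet.{u}) : Prop := ∃ p ∈ G, ∃ s ∈ p, ∃ q ∈ s, OP p x q ∧ OP q z y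

theorem tt_iff {G x z y : ZFSet.{u}} : TT G x z y ↔ ZFSet.pair x (ZFSet.pair z y) ∈ G := by
  unfold TT
  simp only [op_iff]
  constructor
  · rintro ⟨p, hp, s, hs, q, hq, rfl, rfl⟩
    exact hp
  · intro h
    exact ⟨_, h, {x, ZFSet.pair z y}, by simp [ZFSet.pair], ZFSet.pair z y, by simp, rfl, rfl⟩

theorem DD.tt (g i j k : ℕ) : DD.{u} (fun v => TT (v g) (v i) (v j) (v k)) := by
  unfold TT
  exact DD.bex (DD.bex (DD.bex ((DD.op _ _ _).and (DD.op _ _ _))))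

theorem DD.pl (a b c d : ℕ) : DD.{u} (fun v => PL (v a) (v b) (v c) (v d)) := by
  unfold PL
  exact (((DD.mem _ _).or (DD.mem _ _)).and ((DD.mem _ _).or (DD.mem _ _))).or
    ((((DD.mem _ _).or (DD.mem _ _)).and ((DD.mem _ _).or (DD.mem _ _))).not.and
      ((DD.mem _ _).or ((DD.eq _ _).and (DD.mem _ _))))

/-- `G` is the graph of the pairing function on `K` -/
def GAM (K G : ZFSet.{u}) : Prop :=
  ((∀ x ∈ K, ∀ y ∈ x, y ∈ K) ∧ (∀ x ∈ K, ∀ y ∈ x, ∀ z ∈ y, z ∈ x)) ∧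
  (∃ x ∈ K, x = x) ∧
  (∀ x ∈ K, ∀ z ∈ K, ∃ y ∈ K, TT G x z y) ∧
  ∀ x ∈ K, ∀ z ∈ K, ∀ y ∈ K, TT G x z y →
    (∃ u ∈ y, Emp u) ∧
    (∀ u ∈ y, Emp u ∨ ∃ x' ∈ K, ∃ z' ∈ K, PL x' z' x z ∧ TT G x' z' u) ∧
    (∀ x' ∈ K, ∀ z' ∈ K, ∀ u ∈ K, PL x' z' x z → TT G x' z' u → u ∈ y)

theorem DD.gam (i j : ℕ) : DD.{u} (fun v => GAM (v i) (v j)) := by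
  unfold GAM
  refine ((DD.ball (DD.ball (DD.mem _ _))).and (DD.ball (DD.ball (DD.ball (DD.mem _ _))))).and
    ((DD.bex (DD.eq _ _)).and ((DD.ball (DD.ball (DD.bex (DD.tt _ _ _ _)))).and
    (DD.ball (DD.ball (DD.ball ((DD.tt _ _ _ _).imp ((DD.bex (DD.emp _)).and ((DD.ball
      ((DD.emp _).or (DD.bex (DD.bex ((DD.pl _ _ _ _).and (DD.tt _ _ _ _)))))).and
      (DD.ball (DD.ball (DD.ball ((DD.pl _ _ _ _).imp ((DD.tt _ _ _ _).imp
        (DD.mem _ _))))))))))))))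

theorem GAM.ord {K G : ZFSet.{u}} (h : GAM K G) : K.IsOrdinal :=
  ZFSet.isOrdinal_iff_forall_mem_isTransitive.2
    ⟨fun x hx y hy => h.1.1 x hx y hy, fun x hx y hy z hz => h.1.2 x hx y hy z hz⟩

theorem grel_mem {K : ZFSet.{u}} (hK : K.IsOrdinal) {q p : ZFSet.{u} × ZFSet.{u}}
    (h : grel q p) (h1 : p.1 ∈ K) (h2 : p.2 ∈ K) : q.1 ∈ K ∧ q.2 ∈ K := by
  have : ∀ a ∈ gbd p, a ∈ K := by
    intro a ha
    simp only [gbd, ZFSet.mem_union, ZFSet.mem_insert_iff] at ha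
    rcases ha with (rfl | ha) | (rfl | ha)
    · exact h1
    · exact hK.isTransitive _ h1 ha
    · exact h2
    · exact hK.isTransitive _ h2 ha
  exact ⟨this _ (grel_bd h).1, this _ (grel_bd h).2⟩

theorem GAM.aux {K G : ZFSet.{u}} (h : GAM K G) : ∀ p : ZFSet.{u} × ZFSet.{u}, p.1 ∈ K → p.2 ∈ K →
    ∀ y ∈ K, (TT G p.1 p.2 y ↔ y = gg p) := by
  have hK := h.ord
  intro p
  induction p using grel_wf.induction with
  | _ p ih =>
  intro h1 h2
  have key : ∀ y ∈ K, TT G p.1 p.2 y → y = gg p := by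
    intro y hy hT
    obtain ⟨e1, e2, e3⟩ := h.2.2.2 p.1 h1 p.2 h2 y hy hT
    ext u
    rw [mem_gg]
    constructor
    · intro hu
      rcases e2 u hu with hu' | ⟨x', hx', z', hz', hpl, ht⟩
      · exact Or.inl (emp_iff.1 hu')
      · have hg := (PL_iff (hK.mem hx') (hK.mem hz') (hK.mem h1) (hK.mem h2)).1 hpl
        exact Or.inr ⟨(x', z'), hg, ((ih _ hg hx' hz' u (hK.isTransitive _ hy hu)).1 ht).symm⟩
    · rintro (rfl | ⟨q, hq, rfl⟩)
      · obtain ⟨u, hu, hu'⟩ := e1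
        rwa [emp_iff.1 hu'] at hu
      · obtain ⟨q1, q2⟩ := grel_mem hK hq h1 h2
        obtain ⟨u, hu, hT'⟩ := h.2.2.1 q.1 q1 q.2 q2
        have := (ih q hq q1 q2 u hu).1 hT'
        rw [← this]
        exact e3 _ q1 _ q2 u hu ((PL_iff hq.1.1 hq.1.2.1 hq.1.2.2.1 hq.1.2.2.2).2 hq) hT'
  intro y hy
  refine ⟨key y hy, ?_⟩
  rintro rfl
  obtain ⟨u, hu, hT⟩ := h.2.2.1 p.1 h1 p.2 h2
  rwa [key u hu hT] at hT

theorem GAM.tt_iff {K G : ZFSet.{u}} (h : GAM K G) {x z y : ZFSet.{u}} (hx : x ∈ K) (hz : z ∈ K)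
    (hy : y ∈ K) : TT G x z y ↔ y = gg (x, z) := h.aux (x, z) hx hz y hy

theorem GAM.gg_mem {K G : ZFSet.{u}} (h : GAM K G) {x z : ZFSet.{u}} (hx : x ∈ K) (hz : z ∈ K) :
    gg (x, z) ∈ K := by
  obtain ⟨u, hu, hT⟩ := h.2.2.1 x hx z hz
  rwa [← (h.tt_iff hx hz hu).1 hT]

theorem GAM.empty_mem {K G : ZFSet.{u}} (h : GAM K G) : ∅ ∈ K := by
  obtain ⟨x, hx, -⟩ := h.2.1
  obtain ⟨y, hy, hT⟩ := h.2.2.1 x hx x hx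
  obtain ⟨⟨u, hu, hu'⟩, -⟩ := h.2.2.2 x hx x hx y hy hT
  rw [← emp_iff.1 hu']
  exact h.1.1 y hy u hu

theorem GAM.enc_mem {K G : ZFSet.{u}} (h : GAM K G) :
    ∀ {L : List ZFSet.{u}}, (∀ x ∈ L, x ∈ K) → enc L ∈ K
  | [], _ => h.empty_mem
  | x :: L, hL => h.gg_mem (hL x (by simp)) (h.enc_mem (fun y hy => hL y (by simp [hy])))

def EncR (K G : ZFSet.{u}) : List ZFSet.{u} → ZFSet.{u} → Prop
  | [], y => y ∈ K ∧ Emp y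
  | x :: L, y => y ∈ K ∧ x ∈ K ∧ ∃ z ∈ K, EncR K G L z ∧ TT G x z y

theorem GAM.encR_iff {K G : ZFSet.{u}} (h : GAM K G) : ∀ (L : List ZFSet.{u}) (y : ZFSet.{u}),
    EncR K G L y ↔ y ∈ K ∧ (∀ x ∈ L, x ∈ K) ∧ y = enc L
  | [], y => by simp [EncR, emp_iff, enc]
  | x :: L, y => by
    simp only [EncR, h.encR_iff L, List.forall_mem_cons, enc]
    constructor
    · rintro ⟨hy, hx, z, hz, ⟨-, hL, rfl⟩, hT⟩
      exact ⟨hy, ⟨hx, hL⟩, (h.tt_iff hx hz hy).1 hT⟩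
    · rintro ⟨hy, ⟨hx, hL⟩, he⟩
      have hz := h.enc_mem hL
      exact ⟨hy, hx, enc L, hz, ⟨hz, hL, rfl⟩, (h.tt_iff hx hz hy).2 he⟩

theorem DD.encR (l : List ℕ) : ∀ (a b y : ℕ) (g : ℕ → ℕ),
    DD.{u} (fun v => EncR (v a) (v b) (l.map (fun i => v (g i))) (v y)) := by
  induction l with
  | nil =>
    intro a b y g
    exact (DD.mem _ _).and (DD.emp _)
  | cons i l ih =>
    intro a b y g
    simp only [List.map_cons, EncR]
    exact (DD.mem _ _).and ((DD.mem _ _).and (DD.bex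
      ((ih (a + 1) (b + 1) 0 (fun i => g i + 1)).and (DD.tt _ _ _ _))))

/-! ### Translating second-order formulas -/

def dec (K X : ZFSet.{u}) : Rels.{u} := {L | (∀ x ∈ L, x ∈ K) ∧ enc L ∈ X}

def pad {α : Type*} (k : ℕ) (L : List α) (x : α) : List α :=
  L ++ List.replicate (Nat.pair k L.length - L.length) x

def ID (K A : ZFSet.{u}) (k : ℕ) : Rels.{u} :=
  {L | (∀ x ∈ L, x ∈ K) ∧ ∃ x ∈ K, enc (pad k L x) ∈ A}

theorem pad_mem {K : ZFSet.{u}} {k : ℕ} {L : List ZFSet.{u}} {x : ZFSet.{u}}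
    (hL : ∀ y ∈ L, y ∈ K) (hx : x ∈ K) : ∀ y ∈ pad k L x, y ∈ K := by
  intro y hy
  rcases List.mem_append.1 hy with hy | hy
  · exact hL y hy
  · rw [List.eq_of_mem_replicate hy]
    exact hx

theorem pad_length {α : Type*} (k : ℕ) (L : List α) (x : α) :
    (pad k L x).length = Nat.pair k L.length := by
  unfold pad
  rw [List.length_append, List.length_replicate]
  have := Nat.right_le_pair k L.length
  omega

theorem pad_inj {α : Type*} {k k' : ℕ} {L L' : List α} {x x' : α} (h : pad k L x = pad k' L' x') :
    k = k' ∧ L = L' := by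
  have hl := congrArg List.length h
  rw [pad_length, pad_length, Nat.pair_eq_pair] at hl
  exact ⟨hl.1, List.append_inj_left h hl.2⟩

def SemT (φ : SO) (v : ℕ → ZFSet.{u}) : Prop :=
  GAM (v 1) (v 2) ∧ SatSO (v 1).toSet (ID (v 1) (v 0)) φ (fun i => v (2 * i + 3))
    (fun k => dec (v 1) (v (2 * k + 4)))

theorem DD.fo {φ : SO} (h : φ.FO) : DD.{u} (SemT φ) := by
  induction h with
  | mem i j => exact (DD.gam _ _).and (DD.mem _ _)
  | eq i j => exact (DD.gam _ _).and (DD.eq _ _)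
  | rel k l =>
    have h1 : DD.{u} (fun v => ∃ x ∈ v 1, ∃ y ∈ v 0,
        EncR (v 1) (v 2) (pad k (l.map (fun i => v (2 * i + 3))) x) y) := by
      refine DD.bex (DD.bex ?_)
      refine (DD.encR ((l.map (fun i => 2 * i + 5)) ++
        List.replicate (Nat.pair k l.length - l.length) 1) 3 4 0 id).congr (fun v => ?_)
      simp [pad, List.map_map, Function.comp_def]
    refine ((DD.gam 1 2).and h1).congr (fun v => and_congr_right fun hG => ?_)
    simp only [SatSO, ID, Set.mem_ofPred_eq, hG.encR_iff]
    constructor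
    · rintro ⟨x, hx, y, hy, hyK, hL, rfl⟩
      exact ⟨fun z hz => hL z (List.mem_append.2 (Or.inl hz)), x, hx, hy⟩
    · rintro ⟨hL, x, hx, hy⟩
      exact ⟨x, hx, _, hy, hG.enc_mem (pad_mem hL hx), pad_mem hL hx, rfl⟩
  | svar k l =>
    have h1 : DD.{u} (fun v => ∃ y ∈ v (2 * k + 4),
        EncR (v 1) (v 2) (l.map (fun i => v (2 * i + 3))) y) :=
      DD.bex (DD.encR l 2 3 0 (fun i => 2 * i + 4))
    refine ((DD.gam 1 2).and h1).congr (fun v => and_congr_right fun hG => ?_)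
    simp only [SatSO, dec, Set.mem_ofPred_eq, hG.encR_iff]
    constructor
    · rintro ⟨y, hy, hyK, hL, rfl⟩
      exact ⟨hL, hy⟩
    · rintro ⟨hL, hy⟩
      exact ⟨_, hy, hG.enc_mem hL, hL, rfl⟩
  | not _ ih =>
    refine ((DD.gam 1 2).and ih.not).congr (fun v => ?_)
    simp only [SemT, SatSO]
    tauto
  | and _ _ ih1 ih2 =>
    refine (ih1.and ih2).congr (fun v => ?_)
    simp only [SemT, SatSO]
    tauto
  | fex k _ ih =>
    refine ((DD.gam 1 2).and (DD.bexU (2 * k + 3) 1 (by omega) ih)).congr (fun v => ?_)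
    have e : ∀ x : ZFSet.{u}, (fun i => Function.update v (2 * k + 3) x (2 * i + 3)) =
        Function.update (fun i => v (2 * i + 3)) k x := by
      intro x
      funext i
      by_cases hik : i = k
      · subst hik; simp
      · rw [Function.update_of_ne hik, Function.update_of_ne (by omega)]
    have e0 : ∀ (x : ZFSet.{u}) (j : ℕ), j ≠ 2 * k + 3 →
        Function.update v (2 * k + 3) x j = v j :=
      fun x j hj => Function.update_of_ne hj _ _
    have e1 : ∀ (x : ZFSet.{u}),
        (fun j => dec (v 1) (Function.update v (2 * k + 3) x (2 * j + 4))) =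
        fun j => dec (v 1) (v (2 * j + 4)) := by
      intro x
      funext j
      rw [e0 x _ (by omega)]
    simp only [SemT, SatSO, e, e0 _ 0 (by omega), e0 _ 1 (by omega), e0 _ 2 (by omega), e1]
    refine and_congr_right fun hG => exists_congr fun x => and_congr_right fun hx => ?_
    exact and_iff_right hG

theorem semT_upd (φ : SO) (v : ℕ → ZFSet.{u}) (k : ℕ) (x : ZFSet.{u}) :
    SemT φ (Function.update v (2 * k + 4) x) ↔ GAM (v 1) (v 2) ∧
      SatSO (v 1).toSet (ID (v 1) (v 0)) φ (fun i => v (2 * i + 3))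
      (Function.update (fun k => dec (v 1) (v (2 * k + 4))) k (dec (v 1) x)) := by
  have e0 : ∀ (j : ℕ), j ≠ 2 * k + 4 → Function.update v (2 * k + 4) x j = v j :=
    fun j hj => Function.update_of_ne hj _ _
  have e1 : (fun j => dec (v 1) (Function.update v (2 * k + 4) x (2 * j + 4))) =
      Function.update (fun k => dec (v 1) (v (2 * k + 4))) k (dec (v 1) x) := by
    funext i
    by_cases hik : i = k
    · subst hik; simp
    · rw [Function.update_of_ne hik, Function.update_of_ne (by omega)]
  have e2 : (fun i => Function.update v (2 * k + 4) x (2 * i + 3)) =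
      fun i => v (2 * i + 3) := by
    funext i
    exact e0 _ (by omega)
  simp only [SemT, e0 0 (by omega), e0 1 (by omega), e0 2 (by omega), e1, e2]

theorem exists_dec {K G : ZFSet.{u}} (h : GAM K G) {R : Rels.{u}} (hR : ∀ l ∈ R, ∀ x ∈ l, x ∈ K) :
    ∃ X, X ⊆ K ∧ dec K X = R := by
  have hK := h.ord
  refine ⟨ZFSet.sep (fun z => ∃ L ∈ R, enc L = z) K, fun z hz => (ZFSet.mem_sep.1 hz).1, ?_⟩
  ext L
  simp only [dec, Set.mem_ofPred_eq, ZFSet.mem_sep]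
  constructor
  · rintro ⟨hL, -, L', hL', he⟩
    rw [← enc_inj L' L (fun x hx => hK.mem (hR L' hL' x hx)) (fun x hx => hK.mem (hL x hx)) he]
    exact hL'
  · intro hL
    exact ⟨hR L hL, h.enc_mem (hR L hL), L, hL, rfl⟩

def FullT (χ : SF) (φ : SO) : Prop :=
  ∀ S : Set ZFSet.{u}, (∀ x ∈ S, ∀ y ∈ x, y ∈ S) → ∀ v : ℕ → ZFSet.{u}, (∀ i, v i ∈ S) →
    (∀ X, X ⊆ v 1 → X ∈ S) → (SatIn ∅ S χ v ↔ SemT φ v)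

theorem upd_in {S : Set ZFSet.{u}} {v : ℕ → ZFSet.{u}} (hv : ∀ i, v i ∈ S) {x : ZFSet.{u}}
    (hx : x ∈ S) (k : ℕ) : ∀ i, Function.update v k x i ∈ S := by
  intro i
  by_cases hik : i = k
  · subst hik; simpa using hx
  · rw [Function.update_of_ne hik]; exact hv i

theorem isPi_not {n : ℕ} {χ : SF} (h : IsSigma n χ) : IsPi n (.not χ) := by
  cases n with
  | zero => cases h with | of_zero h => exact .of_zero (.not h)
  | succ n => exact .not h

theorem FullT.sex {χ : SF} {φ : SO} (h : FullT.{u} χ φ) (k : ℕ) :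
    FullT.{u} (.ex (2 * k + 4) χ) (.not (.sall k (.not φ))) := by
  intro S hS v hv hX
  have e : ∀ x ∈ S, (SatIn ∅ S χ (Function.update v (2 * k + 4) x) ↔ _) := fun x hx =>
    (h S hS _ (upd_in hv hx _) (by
      rw [Function.update_of_ne (by omega)]; exact hX)).trans (semT_upd φ v k x)
  unfold SemT
  rw [sat_sex]
  constructor
  · rintro ⟨x, hx, hs⟩
    obtain ⟨hG, hs⟩ := (e x hx).1 hs
    exact ⟨hG, dec (v 1) x, fun l hl => hl.1, hs⟩
  · rintro ⟨hG, R, hR, hs⟩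
    obtain ⟨X, hXs, rfl⟩ := exists_dec hG hR
    exact ⟨X, hX X hXs, (e X (hX X hXs)).2 ⟨hG, hs⟩⟩

theorem FullT.sall {σ : SF} {φ : SO} (h : FullT.{u} (.not σ) φ) (k : ℕ) :
    FullT.{u} (.not (.ex (2 * k + 4) σ)) (.sall k φ) := by
  intro S hS v hv hX
  have e : ∀ x ∈ S, (SatIn ∅ S (.not σ) (Function.update v (2 * k + 4) x) ↔ _) := fun x hx =>
    (h S hS _ (upd_in hv hx _) (by
      rw [Function.update_of_ne (by omega)]; exact hX)).trans (semT_upd φ v k x)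
  have e' : SatIn ∅ S (.not (.ex (2 * k + 4) σ)) v ↔
      ∀ x ∈ S, SatIn ∅ S (.not σ) (Function.update v (2 * k + 4) x) := by
    simp only [SatIn, Sat]
    push Not
    rfl
  rw [e']
  unfold SemT
  constructor
  · intro hs
    have hG := ((e _ (hv 0)).1 (hs _ (hv 0))).1
    refine ⟨hG, fun R hR => ?_⟩
    obtain ⟨X, hXs, rfl⟩ := exists_dec hG hR
    exact ((e X (hX X hXs)).1 (hs _ (hX X hXs))).2
  · rintro ⟨hG, hs⟩ x hx
    exact (e x hx).2 ⟨hG, hs _ (fun l hl => hl.1)⟩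

mutual
theorem piOne_tr : ∀ {n : ℕ} {φ : SO}, IsPiOne n φ → ∃ χ, IsPi n χ ∧ FullT.{u} χ φ
  | _, _, .of_fo h => by
    obtain ⟨χ, h1, h2⟩ := DD.fo.{u} h
    exact ⟨χ, .of_zero h1, fun S hS v hv _ => h2 S hS v hv⟩
  | _, _, .of_sigma h => by
    obtain ⟨χ, h1, h2⟩ := sigmaOne_tr h
    refine ⟨.not (.not χ), .not (.of_pi (isPi_not h1)), fun S hS v hv hX => ?_⟩
    rw [← h2 S hS v hv hX]
    exact not_not
  | _, _, .sall k h => by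
    obtain ⟨χ, h1, h2⟩ := piOne_tr h
    cases h1 with
    | not h1 => exact ⟨_, .not (.ex _ h1), h2.sall k⟩
theorem sigmaOne_tr : ∀ {n : ℕ} {φ : SO}, IsSigmaOne n φ → ∃ χ, IsSigma n χ ∧ FullT.{u} χ φ
  | _, _, .of_fo h => by
    obtain ⟨χ, h1, h2⟩ := DD.fo.{u} h
    exact ⟨χ, .of_zero h1, fun S hS v hv _ => h2 S hS v hv⟩
  | _, _, .of_pi h => by
    obtain ⟨χ, h1, h2⟩ := piOne_tr h
    exact ⟨χ, .of_pi h1, h2⟩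
  | _, _, .sex k h => by
    obtain ⟨χ, h1, h2⟩ := sigmaOne_tr h
    exact ⟨_, .ex _ h1, h2.sex k⟩
end

/-! ### From shrewdness to indescribability -/

theorem SF.fv_bdd (φ : SF) : ∃ N, ∀ i ∈ φ.fv, i < N := by
  induction φ with
  | mem i j =>
    refine ⟨i + j + 1, fun a ha => ?_⟩
    rcases ha with rfl | ha
    · omega
    · rw [Set.mem_singleton_iff.1 ha]; omega
  | eq i j =>
    refine ⟨i + j + 1, fun a ha => ?_⟩
    rcases ha with rfl | ha
    · omega
    · rw [Set.mem_singleton_iff.1 ha]; omega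
  | pred i =>
    refine ⟨i + 1, fun a ha => ?_⟩
    rw [Set.mem_singleton_iff.1 ha]; omega
  | not _ ih => exact ih
  | and _ _ ih1 ih2 =>
    obtain ⟨N, hN⟩ := ih1
    obtain ⟨M, hM⟩ := ih2
    refine ⟨N + M, fun a ha => ?_⟩
    rcases ha with ha | ha
    · have := hN a ha; omega
    · have := hM a ha; omega
  | ex k _ ih =>
    obtain ⟨N, hN⟩ := ih
    exact ⟨N, fun a ha => hN a ha.1⟩

def exF : ℕ → SF → SF
  | 0, χ => χ
  | N + 1, χ => exF N (.ex (N + 2) χ)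

theorem exF_sigma {n : ℕ} (N : ℕ) : ∀ {χ : SF}, IsSigma (n + 1) χ → IsSigma (n + 1) (exF N χ) := by
  induction N with
  | zero => exact fun h => h
  | succ N ih => exact fun h => ih (.ex _ h)

theorem exF_fv (N : ℕ) : ∀ (χ : SF), ∀ i ∈ (exF N χ).fv, i ∈ χ.fv ∧ (i < 2 ∨ N + 2 ≤ i) := by
  induction N with
  | zero => exact fun χ i hi => ⟨hi, by omega⟩
  | succ N ih =>
    intro χ i hi
    obtain ⟨⟨h1, h2⟩, h3⟩ := ih _ i hi
    have h2 : i ≠ N + 2 := h2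
    exact ⟨h1, by omega⟩

theorem exF_sat (S : Set ZFSet.{u}) (N : ℕ) : ∀ (χ : SF) (v : ℕ → ZFSet.{u}),
    SatIn ∅ S (exF N χ) v ↔ ∃ v', (∀ i, i < 2 ∨ N + 2 ≤ i → v' i = v i) ∧
      (∀ i, 2 ≤ i → i < N + 2 → v' i ∈ S) ∧ SatIn ∅ S χ v' := by
  induction N with
  | zero =>
    intro χ v
    constructor
    · exact fun h => ⟨v, fun _ _ => rfl, fun i h1 h2 => by omega, h⟩
    · rintro ⟨v', h1, -, h⟩
      have : v' = v := funext fun i => h1 i (by omega)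
      rwa [this] at h
  | succ N ih =>
    intro χ v
    rw [exF, ih]
    constructor
    · rintro ⟨v', h1, h2, x, hx, h⟩
      refine ⟨Function.update v' (N + 2) x, fun i hi => ?_, fun i hi hi' => ?_, h⟩
      · rw [Function.update_of_ne (by omega)]
        exact h1 i (by omega)
      · by_cases hik : i = N + 2
        · rw [hik, Function.update_self]
          exact hx
        · rw [Function.update_of_ne hik]
          exact h2 i hi (by omega)
    · rintro ⟨v', h1, h2, h⟩
      refine ⟨Function.update v' (N + 2) (v (N + 2)), fun i hi => ?_, fun i hi hi' => ?_,
        v' (N + 2), h2 _ (by omega) (by omega), ?_⟩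
      · by_cases hik : i = N + 2
        · rw [hik, Function.update_self]
        · rw [Function.update_of_ne hik]
          exact h1 i (by omega)
      · rw [Function.update_of_ne (by omega)]
        exact h2 i hi (by omega)
      · rw [Function.update_idem, Function.update_eq_self]
        exact h

theorem ID_eq {κ lam A : ZFSet.{u}} {I : ℕ → Rels.{u}} (hκ : κ.IsOrdinal) (hl : lam ⊆ κ)
    (h0 : ∅ ∈ lam) (he : ∀ L : List ZFSet.{u}, (∀ x ∈ L, x ∈ lam) → enc L ∈ lam)
    (hI : ∀ k, ∀ l ∈ I k, ∀ x ∈ l, x ∈ κ)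
    (hA : ∀ y, y ∈ A ↔ y ∈ κ ∧ ∃ k, ∃ L ∈ I k, ∃ x ∈ κ, y = enc (pad k L x)) :
    ID lam (A ∩ lam) = restrictRel I lam := by
  funext k
  ext L
  simp only [ID, restrictRel, Set.mem_ofPred_eq, ZFSet.mem_inter, hA]
  constructor
  · rintro ⟨hL, x, hx, ⟨-, k', L', hL', x', hx', e⟩, -⟩
    have := enc_inj _ _ (fun y hy => hκ.mem (hl (pad_mem hL hx y hy)))
      (fun y hy => hκ.mem (pad_mem (hI k' L' hL') hx' y hy)) e
    obtain ⟨rfl, rfl⟩ := pad_inj this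
    exact ⟨hL', hL⟩
  · rintro ⟨hL, hL'⟩
    have := he _ (pad_mem (k := k) hL' h0)
    exact ⟨hL', ∅, h0, ⟨hl this, k, L, hL, ∅, hl h0, rfl⟩, this⟩

/-- the graph of pairing -/
noncomputable def graph (κ : ZFSet.{u}) : ZFSet.{u} :=
  ZFSet.sep (fun w => ∃ x z, w = ZFSet.pair x (ZFSet.pair z (gg (x, z))))
    (ZFSet.prod κ (ZFSet.prod κ κ))

theorem tt_graph {κ x z y : ZFSet.{u}} :
    TT (graph κ) x z y ↔ (x ∈ κ ∧ z ∈ κ ∧ y ∈ κ) ∧ y = gg (x, z) := by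
  rw [tt_iff]
  unfold graph
  rw [ZFSet.mem_sep, ZFSet.pair_mem_prod, ZFSet.pair_mem_prod]
  refine and_congr_right fun _ => ?_
  constructor
  · rintro ⟨x', z', h⟩
    obtain ⟨rfl, h⟩ := ZFSet.pair_inj.1 h
    obtain ⟨rfl, h⟩ := ZFSet.pair_inj.1 h
    exact h
  · rintro rfl
    exact ⟨x, z, rfl⟩

theorem graph_mem {κ : ZFSet.{u}} (h : InfCard κ) : graph κ ∈ HS κ := by
  have h0 := h.aleph0_le
  have hc := (zcard_iff.1 h.1).1
  have hm : ∀ x ∈ κ, x ∈ HS κ := fun x hx => HS_sub hc.isTransitive (hc.isTransitive x hx)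
  refine HS_closed h0 ?_ ?_
  · have e := Cardinal.mul_eq_self h0
    refine (ZFSet.card_mono (fun z hz => (ZFSet.mem_sep.1 hz).1)).trans
      ((card_prod_le _ _).trans ?_)
    calc κ.card * (ZFSet.prod κ κ).card ≤ κ.card * (κ.card * κ.card) := by
          gcongr
          exact card_prod_le _ _
      _ = κ.card := by rw [e, e]
  · intro w hw
    obtain ⟨x, hx, w', hw', rfl⟩ := ZFSet.mem_prod.1 (ZFSet.mem_sep.1 hw).1
    obtain ⟨z, hz, y, hy, rfl⟩ := ZFSet.mem_prod.1 hw'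
    exact HS_pair h0 (hm x hx) (HS_pair h0 (hm z hz) (hm y hy))

theorem gam_graph {κ : ZFSet.{u}} (h : InfCard κ) : GAM κ (graph κ) := by
  have hc := (zcard_iff.1 h.1).1
  refine ⟨⟨fun x hx y hy => hc.isTransitive x hx hy,
    fun x hx y hy z hz => (hc.mem hx).isTransitive y hy hz⟩, ⟨∅, h.2 ZFSet.omega_zero, rfl⟩, ?_, ?_⟩
  · intro x hx z hz
    exact ⟨_, gg_mem h hx hz, tt_graph.2 ⟨⟨hx, hz, gg_mem h hx hz⟩, rfl⟩⟩
  · intro x hx z hz y hy hT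
    obtain ⟨-, rfl⟩ := tt_graph.1 hT
    refine ⟨⟨∅, (mem_gg _ _).2 (Or.inl rfl), emp_iff.2 rfl⟩, ?_, ?_⟩
    · intro t ht
      rcases (mem_gg _ _).1 ht with rfl | ⟨q, hq, rfl⟩
      · exact Or.inl (emp_iff.2 rfl)
      · obtain ⟨q1, q2⟩ := grel_mem hc hq hx hz
        exact Or.inr ⟨q.1, q1, q.2, q2,
          (PL_iff hq.1.1 hq.1.2.1 (hc.mem hx) (hc.mem hz)).2 hq,
          tt_graph.2 ⟨⟨q1, q2, gg_mem h q1 q2⟩, rfl⟩⟩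
    · intro x' hx' z' hz' t ht hpl hT'
      obtain ⟨-, rfl⟩ := tt_graph.1 hT'
      exact (mem_gg _ _).2 (Or.inr ⟨(x', z'),
        (PL_iff (hc.mem hx') (hc.mem hz') (hc.mem hx) (hc.mem hz)).1 hpl, rfl⟩)

theorem shrewd_to_ind {n : ℕ} {κ θ : ZFSet.{u}} (hθ : SuccCardOf θ κ)
    (h : WeaklyShrewdAt ∅ (n + 1) θ κ) : WeaklyPiOneIndescribable n κ := by
  obtain ⟨hκ, -, h⟩ := h
  refine ⟨hκ, fun Φ I hΦ hsent hI hsat => ?_⟩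
  have hc := (zcard_iff.1 hκ.1).1
  obtain ⟨χ, hχ, hF⟩ := piOne_tr.{u} hΦ
  obtain ⟨N, hN⟩ := χ.fv_bdd
  have hcoinc : ∀ (D : Set ZFSet.{u}) (J : ℕ → Rels.{u}) (v v' w w'),
      SatSO D J Φ v w ↔ SatSO D J Φ v' w' := fun D J v v' w w' =>
    SO.coinc D J Φ v v' w w' (fun i hi => by rw [hsent.1] at hi; exact absurd hi (Set.notMem_empty _))
      (fun i hi => by rw [hsent.2] at hi; exact absurd hi (Set.notMem_empty _))
  set A : ZFSet.{u} :=
    ZFSet.sep (fun y => ∃ k, ∃ L ∈ I k, ∃ x ∈ κ, y = enc (pad k L x)) κ with hAdef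
  have hA : ∀ y, y ∈ A ↔ y ∈ κ ∧ ∃ k, ∃ L ∈ I k, ∃ x ∈ κ, y = enc (pad k L x) :=
    fun y => ZFSet.mem_sep
  have hAκ : A ⊆ κ := fun y hy => ((hA y).1 hy).1
  have hval : ∀ (S : Set ZFSet.{u}) (B K : ZFSet.{u}), B ⊆ K → (∀ X, X ⊆ K → X ∈ S) →
      ∀ i, val2 B K i ∈ S := by
    intro S B K hB hS i
    unfold val2
    split_ifs
    · exact hS _ hB
    · exact hS _ (fun _ hx => hx)
    · exact hS _ (fun x hx => absurd hx (ZFSet.notMem_empty _))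
  have hG := gam_graph hκ
  have hIκ : ID κ A = I := by
    have e := ID_eq hc (fun _ hx => hx) hG.empty_mem (fun L hL => hG.enc_mem hL) hI hA
    have e1 : A ∩ κ = A := by
      ext y
      rw [ZFSet.mem_inter]
      exact ⟨fun hy => hy.1, fun hy => ⟨hy, hAκ hy⟩⟩
    rw [e1] at e
    rw [e]
    funext k
    ext L
    simp only [restrictRel, Set.mem_ofPred_eq]
    exact ⟨fun hL => hL.1, fun hL => ⟨hL, hI k L hL⟩⟩
  have hsub : ∀ X, X ⊆ κ → X ∈ HSet θ := fun X hX => by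
    rw [HSet_eq_HS (succCardOf_card hθ)]
    exact HS_sub hc.isTransitive hX
  have hgr : graph κ ∈ HSet θ := by
    rw [HSet_eq_HS (succCardOf_card hθ)]
    exact graph_mem hκ
  have hfv : (exF (N + 1) χ).fv ⊆ {0, 1} := by
    intro i hi
    obtain ⟨h1, h2⟩ := exF_fv _ _ i hi
    have := hN i h1
    have : i = 0 ∨ i = 1 := by omega
    exact this
  have hst : SatIn ∅ (HSet θ) (exF (N + 1) χ) (val2 A κ) := by
    rw [exF_sat]
    have hv := upd_in (hval (HSet θ) A κ hAκ hsub) hgr 2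
    refine ⟨Function.update (val2 A κ) 2 (graph κ), fun i hi => ?_, fun i _ _ => hv i, ?_⟩
    · rw [Function.update_of_ne (by omega)]
    · have e0 : Function.update (val2 A κ) 2 (graph κ) 0 = A := rfl
      have e1 : Function.update (val2 A κ) 2 (graph κ) 1 = κ := rfl
      have e2 : Function.update (val2 A κ) 2 (graph κ) 2 = graph κ := rfl
      refine (hF _ HSet_trans _ hv (by rw [e1]; exact hsub)).2 ?_
      unfold SemT
      rw [e0, e1, e2, hIκ]
      exact ⟨hG, (hcoinc _ _ _ _ _ _).1 hsat⟩
  obtain ⟨κ', θ', hκ', hθ', hκθ, hκκ, hs⟩ :=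
    h (exF (N + 1) χ) A hfv (exF_sigma _ (.of_pi hχ)) hAκ hst
  refine ⟨κ', hκκ, ?_⟩
  obtain ⟨v, hv1, hv2, hv⟩ := (exF_sat _ _ _ _).1 hs
  have hsub' : ∀ X, X ⊆ κ' → X ∈ HSet θ' := fun X hX =>
    ⟨κ', hκ'.1.1, hX, hθ'.2 _ hκθ⟩
  have hv0 := hval (HSet θ') (A ∩ κ') κ' (fun y hy => (ZFSet.mem_inter.1 hy).2) hsub'
  have e0 : v 0 = A ∩ κ' := hv1 0 (by omega)
  have e1 : v 1 = κ' := hv1 1 (by omega)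
  have := (hF _ HSet_trans v (fun i => by
    by_cases hi : i < 2 ∨ N + 1 + 2 ≤ i
    · rw [hv1 i hi]; exact hv0 i
    · exact hv2 i (by omega) (by omega)) (by rw [e1]; exact hsub')).1 hv
  obtain ⟨hG', hSat⟩ := this
  rw [e1] at hG'
  rw [e0, e1, ID_eq hc (hc.isTransitive _ hκκ) hG'.empty_mem (fun L hL => hG'.enc_mem hL) hI hA]
    at hSat
  exact (hcoinc _ _ _ _ _ _).1 hSat
/-- For every `n > 0`, a cardinal `κ` is weakly `Π¹ₙ`-indescribable if and only
if it is weakly `(Σ_{n+1}, ∅, κ⁺)`-shrewd. -/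
theorem weaklyPiOneInd_iff_weaklyShrewdAt (n : ℕ) (hn : 0 < n)
    (κ θ : ZFSet.{u}) (hθ : SuccCardOf θ κ) :
    WeaklyPiOneIndescribable n κ ↔ WeaklyShrewdAt ∅ (n + 1) θ κ := by
  obtain ⟨m, rfl⟩ : ∃ m, n = m + 1 := ⟨n - 1, by omega⟩
  exact ⟨fun h => ind_to_shrewd hθ h, fun h => shrewd_to_ind hθ h⟩
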